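/- arXiv:2005.02250 — 3 statements merged into one kernel-verified Lean document; each statement's English description precedes it below -/
import Mathlib

section
/- For every positive integer ω, the supremum of the chromatic number χ(G) over all finite (P5, banner)-free graphs G with clique number ω(G) = ω equals the supremum of χ(H) over all finite 3K1-free graphs H with ω(H) = ω. -/
open SimpleGraph

/-- `G` is `H`-free: no induced subgraph of `G` is isomorphic to `H`. -/
def IndFree {α β : Type*} (H : SimpleGraph α) (G : SimpleGraph β) : Prop :=
  ∀ s : Set β, ¬ Nonempty (H ≃g G.induce s)

/-- The banner: a 4-cycle `0-1-2-3-0` together with a pendant vertex `4` adjacent to `0`. -/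
def banner : SimpleGraph (Fin 5) :=
  SimpleGraph.fromEdgeSet {s(0,1), s(1,2), s(2,3), s(3,0), s(0,4)}

/-- The co-banner: the complement of the banner. -/
def coBanner : SimpleGraph (Fin 5) := bannerᶜ

/-- `2K₂`: the disjoint union of two edges. -/
def twoK2 : SimpleGraph (Fin 4) := SimpleGraph.fromEdgeSet {s(0,1), s(2,3)}

/-- `3K₁`: three pairwise nonadjacent vertices. -/
def threeK1 : SimpleGraph (Fin 3) := ⊥

/-- The 5-wheel: a 5-cycle `0-1-2-3-4-0` plus a hub `5` adjacent to all cycle vertices. -/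
def wheel5 : SimpleGraph (Fin 6) :=
  SimpleGraph.fromEdgeSet
    {s(0,1), s(1,2), s(2,3), s(3,4), s(4,0), s(5,0), s(5,1), s(5,2), s(5,3), s(5,4)}

/-- A nonempty set `M` is a module if every vertex outside `M` is adjacent to all
or to none of the vertices of `M`. -/
def IsModule {V : Type*} (G : SimpleGraph V) (M : Set V) : Prop :=
  M.Nonempty ∧ ∀ v ∉ M, (∀ u ∈ M, G.Adj v u) ∨ (∀ u ∈ M, ¬ G.Adj v u)

/-- `X` is a clique-separator of modules in `G`. -/
def IsCliqueSeparatorOfModules {V : Type*} (G : SimpleGraph V) (X : Set V) : Prop :=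
  (∃ (k : ℕ) (Xs : Fin k → Set V),
      (∀ i, IsModule G (Xs i)) ∧
      (∀ i j, i ≠ j → Disjoint (Xs i) (Xs j)) ∧
      (∀ i j, i ≠ j → ∀ u ∈ Xs i, ∀ v ∈ Xs j, G.Adj u v) ∧
      X = ⋃ i, Xs i) ∧
  (∃ A B : Set V, A ∪ B = Set.univ ∧ (A \ B).Nonempty ∧ (B \ A).Nonempty ∧
      (∀ a ∈ A \ B, ∀ b ∈ B \ A, ¬ G.Adj a b) ∧ A ∩ B = X)

/-- A graph is prime if it has no homogeneous set,
i.e. no module `M` with `1 < |M| < |V(G)|`. -/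
def IsPrime {V : Type*} (G : SimpleGraph V) : Prop :=
  ¬ ∃ M : Set V, IsModule G M ∧ 1 < M.ncard ∧ M.ncard < Nat.card V

/-- A nonempty graph is critical if deleting any vertex decreases the chromatic number. -/
def IsCritical {V : Type*} (G : SimpleGraph V) : Prop :=
  Nonempty V ∧ ∀ v : V, (G.induce {u | u ≠ v}).chromaticNumber < G.chromaticNumber

/-- `G` is a `non-empty, 2K₁-free'-expansion of `G'`: the fibres of `f` partition `V(G)`
into nonempty cliques, with complete/empty bipartite connections according to `G'`. -/
def IsExpansionOf {V W : Type*} (G : SimpleGraph V) (G' : SimpleGraph W) : Prop :=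
  ∃ f : V → W, Function.Surjective f ∧
    (∀ u v, u ≠ v → f u = f v → G.Adj u v) ∧
    (∀ u v, f u ≠ f v → (G.Adj u v ↔ G'.Adj (f u) (f v)))

/-- The weighted chromatic number `χ_q(G)`: the least `k` such that every vertex `v`
can be assigned a set of `q v` colours from `{1,…,k}` with disjoint sets on adjacent
vertices. -/
noncomputable def wChromaticNumber {V : Type*} (G : SimpleGraph V) (q : V → ℕ) : ℕ :=
  sInf {k | ∃ L : V → Finset (Fin k), (∀ v, (L v).card = q v) ∧
    ∀ ⦃u v⦄, G.Adj u v → Disjoint (L u) (L v)}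

/-- The weighted clique number `ω_q(G)`: the maximum total weight of a clique. -/
noncomputable def wCliqueNum {V : Type*} (G : SimpleGraph V) (q : V → ℕ) : ℕ :=
  sSup {m | ∃ s : Finset V, G.IsClique (s : Set V) ∧ m = ∑ v ∈ s, q v}

/-- `Q(F)`: a path `u₁u₂u₃u₄` whose third vertex `u₃` has been replaced by a copy of `F`,
each of whose vertices is adjacent to both `u₂` and `u₄`. Here `inr 0 = u₁`, `inr 1 = u₂`,
`inr 2 = u₄`, and `inl w` are the vertices of the copy of `F`. -/
def QGraph {W : Type*} (F : SimpleGraph W) : SimpleGraph (W ⊕ Fin 3) :=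
  SimpleGraph.fromRel (fun a b =>
    (∃ w w', a = Sum.inl w ∧ b = Sum.inl w' ∧ F.Adj w w') ∨
    (a = Sum.inr 0 ∧ b = Sum.inr 1) ∨
    (∃ w, a = Sum.inl w ∧ (b = Sum.inr 1 ∨ b = Sum.inr 2)))

/-- The join of two graphs: all edges of both graphs plus all edges in between. -/
def joinGraph {α β : Type*} (G₁ : SimpleGraph α) (G₂ : SimpleGraph β) :
    SimpleGraph (α ⊕ β) :=
  SimpleGraph.fromRel (fun a b =>
    (∃ u v, a = Sum.inl u ∧ b = Sum.inl v ∧ G₁.Adj u v) ∨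
    (∃ u v, a = Sum.inr u ∧ b = Sum.inr v ∧ G₂.Adj u v) ∨
    (∃ u v, a = Sum.inl u ∧ b = Sum.inr v))

/-- `H` has a spanning complete bipartite subgraph. -/
def HasSpanningCompleteBipartite {α : Type*} (H : SimpleGraph α) : Prop :=
  ∃ A B : Set α, A.Nonempty ∧ B.Nonempty ∧ Disjoint A B ∧ A ∪ B = Set.univ ∧
    ∀ a ∈ A, ∀ b ∈ B, H.Adj a b

/-- `G'` is a `q`-expansion of `G`: each vertex `u` of `G` is replaced by a clique on
`q u` vertices, joined completely or not at all according to adjacency in `G`. -/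
def IsWeightedExpansion {V' V : Type*} (G' : SimpleGraph V') (G : SimpleGraph V)
    (q : V → ℕ) : Prop :=
  ∃ f : V' → V,
    (∀ v : V, Nat.card (f ⁻¹' {v}) = q v) ∧
    (∀ a b : V', a ≠ b → f a = f b → G'.Adj a b) ∧
    (∀ a b : V', f a ≠ f b → (G'.Adj a b ↔ G.Adj (f a) (f b)))

/-- `q` is `⊲`-minimal: no weight function pointwise at most `q` with strictly smaller
total weight has the same weighted chromatic number. -/
def IsTriMinimal {V : Type*} [Fintype V] (G : SimpleGraph V) (q : V → ℕ) : Prop :=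
  ¬ ∃ q' : V → ℕ, (∀ v, q' v ≤ q v) ∧ (∑ v, q' v) < (∑ v, q v) ∧
      wChromaticNumber G q' = wChromaticNumber G q

/-- No induced subgraph on five vertices is a path, stated in terms of the five vertices. -/
def NoInducedP5 {V : Type*} (G : SimpleGraph V) : Prop :=
  ∀ a b c d e, G.Adj a b → G.Adj b c → G.Adj c d → G.Adj d e →
    ¬ G.Adj a c → ¬ G.Adj a d → ¬ G.Adj a e → ¬ G.Adj b d → ¬ G.Adj b e → ¬ G.Adj c e → False

/-- No induced subgraph is a banner, stated in terms of its vertices: `a - x - b - y` is a 4-cycle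
and `z` is pendant at `x`. -/
def NoInducedBanner {V : Type*} (G : SimpleGraph V) : Prop :=
  ∀ a b x y z, G.Adj x a → G.Adj x b → G.Adj y a → G.Adj y b → a ≠ b → ¬ G.Adj a b →
    ¬ G.Adj x y → G.Adj x z → ¬ G.Adj a z → ¬ G.Adj b z → ¬ G.Adj y z → False

/-- No three vertices are pairwise distinct and nonadjacent. -/
def NoIndepTriple {V : Type*} (G : SimpleGraph V) : Prop :=
  ∀ a b c, a ≠ b → a ≠ c → b ≠ c → ¬ G.Adj a b → ¬ G.Adj a c → ¬ G.Adj b c → False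

/-- The vertices outside `S` do not distinguish nonadjacent vertices of `S`; equivalently, `S` is
a join of modules. -/
def IsModuleJoin {V : Type*} (G : SimpleGraph V) (S : Set V) : Prop :=
  ∀ x ∈ S, ∀ y ∈ S, x ≠ y → ¬ G.Adj x y → ∀ z ∉ S, G.Adj z x → G.Adj z y

/-- `G` has no clique-separator of modules. -/
def NoModuleSeparator {V : Type*} (G : SimpleGraph V) : Prop :=
  ∀ L S : Set V, Disjoint L S → L.Nonempty → (∃ r, r ∉ L ∧ r ∉ S) →
    (∀ l ∈ L, ∀ r, r ∉ L → r ∉ S → ¬ G.Adj l r) → ¬ IsModuleJoin G S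

/-- The complement of `G` is connected. -/
def IsCoconnected {V : Type*} (G : SimpleGraph V) : Prop :=
  ∀ P : Set V, P.Nonempty → Pᶜ.Nonempty → ∃ p ∈ P, ∃ q ∉ P, ¬ G.Adj p q

theorem exists_recolorings {V : Type*} [Finite V] (G : SimpleGraph V) {k : ℕ} (c₁ c₂ : V → Fin k)
    (X : Set V) (h₁ : ∀ x ∈ X, ∀ y ∈ X, G.Adj x y → c₁ x ≠ c₁ y)
    (h₂ : ∀ x ∈ X, ∀ y ∈ X, G.Adj x y → c₂ x ≠ c₂ y) :
    ∃ g₁ g₂ : V → Fin k, (∀ x ∈ X, ∃ y ∈ X, g₁ x = c₁ y) ∧ (∀ x ∈ X, ∃ y ∈ X, g₂ x = c₂ y) ∧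
      (∀ x ∈ X, ∀ y ∈ X, (g₁ x = g₁ y ↔ g₂ x = g₂ y)) ∧
      ∀ x ∈ X, ∀ y ∈ X, G.Adj x y → g₂ x ≠ g₂ y := by
  have key : ∀ s t : Set (Fin k), s.ncard ≤ t.ncard →
      ∃ f : Fin k → Fin k, Set.MapsTo f s t ∧ Set.InjOn f s := by
    classical
    intro s t h
    rw [← Nat.card_coe_set_eq, ← Nat.card_coe_set_eq, Nat.card_eq_fintype_card,
      Nat.card_eq_fintype_card] at h
    obtain ⟨e⟩ := Function.Embedding.nonempty_of_card_le h
    refine ⟨fun x => if hx : x ∈ s then e ⟨x, hx⟩ else x, ?_, ?_⟩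
    · intro x hx
      simp [hx]
    · intro x hx y hy hxy
      simpa [hx, hy, Subtype.val_inj] using hxy
  rcases le_total (c₁ '' X).ncard (c₂ '' X).ncard with h | h
  · obtain ⟨f, hm, hi⟩ := key _ _ h
    have hinj : ∀ x ∈ X, ∀ y ∈ X, (c₁ x = c₁ y ↔ f (c₁ x) = f (c₁ y)) := fun x hx y hy =>
      ⟨fun h => by rw [h], fun h => hi ⟨x, hx, rfl⟩ ⟨y, hy, rfl⟩ h⟩
    refine ⟨c₁, f ∘ c₁, fun x hx => ⟨x, hx, rfl⟩, fun x hx => ?_, hinj, ?_⟩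
    · obtain ⟨y, hy, e⟩ := hm ⟨x, hx, rfl⟩
      exact ⟨y, hy, e.symm⟩
    · exact fun x hx y hy hxy e => h₁ x hx y hy hxy ((hinj x hx y hy).2 e)
  · obtain ⟨f, hm, hi⟩ := key _ _ h
    have hinj : ∀ x ∈ X, ∀ y ∈ X, (f (c₂ x) = f (c₂ y) ↔ c₂ x = c₂ y) := fun x hx y hy =>
      ⟨fun h => hi ⟨x, hx, rfl⟩ ⟨y, hy, rfl⟩ h, fun h => by rw [h]⟩
    refine ⟨f ∘ c₂, c₂, fun x hx => ?_, fun x hx => ⟨x, hx, rfl⟩, hinj, h₂⟩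
    obtain ⟨y, hy, e⟩ := hm ⟨x, hx, rfl⟩
    exact ⟨y, hy, e.symm⟩

theorem exists_coloring_of_isModuleJoin {V : Type*} [Finite V] (G : SimpleGraph V) {k : ℕ}
    {L S : Set V} (hLS : Disjoint L S) (hLR : ∀ l ∈ L, ∀ r, r ∉ L → r ∉ S → ¬ G.Adj l r)
    (hS : IsModuleJoin G S) (c₁ c₂ : V → Fin k)
    (h₁ : ∀ x y, (x ∈ L ∨ x ∈ S) → (y ∈ L ∨ y ∈ S) → G.Adj x y → c₁ x ≠ c₁ y)
    (h₂ : ∀ x y, x ∉ L → y ∉ L → G.Adj x y → c₂ x ≠ c₂ y) :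
    G.Colorable k := by
  classical
  let K : SimpleGraph V :=
    { Adj := fun x y => x ∈ S ∧ y ∈ S ∧ x ≠ y ∧ ¬ G.Adj x y
      symm := ⟨fun x y h => ⟨h.2.1, h.1, h.2.2.1.symm, fun h' => h.2.2.2 h'.symm⟩⟩
      loopless := ⟨fun x h => h.2.2.1 rfl⟩ }
  let q : V → K.ConnectedComponent := K.connectedComponentMk
  have hSL : ∀ x ∈ S, x ∉ L := fun x hx hl => Set.disjoint_left.1 hLS hl hx
  have hjoin : ∀ x ∈ S, ∀ y ∈ S, q x ≠ q y → G.Adj x y := by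
    intro x hx y hy hq
    by_contra h
    refine hq (SimpleGraph.ConnectedComponent.sound (SimpleGraph.Adj.reachable ?_))
    exact ⟨hx, hy, fun e => hq (by rw [e]), h⟩
  have hmod : ∀ x y, q x = q y → ∀ z ∉ S, G.Adj z x → G.Adj z y := by
    intro x y h z hz
    replace h := SimpleGraph.ConnectedComponent.exact h
    rw [SimpleGraph.reachable_iff_reflTransGen] at h
    induction h with
    | refl => exact id
    | tail _ hyz ih => exact fun h => hS _ hyz.1 _ hyz.2.1 hyz.2.2.1 hyz.2.2.2 z hz (ih h)
  choose g₁ g₂ hg₁ hg₂ hg hp using fun i => exists_recolorings G c₁ c₂ {x | x ∈ S ∧ q x = i}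
    (fun x hx y hy => h₁ x y (.inr hx.1) (.inr hy.1))
    (fun x hx y hy => h₂ x y (hSL _ hx.1) (hSL _ hy.1))
  let d₁ : V → Fin k := fun x => g₁ (q x) x
  let d₂ : V → Fin k := fun x => g₂ (q x) x
  have e₁ : ∀ x ∈ S, ∃ y ∈ S, q y = q x ∧ d₁ x = c₁ y := fun x hx => by
    obtain ⟨y, hy, e⟩ := hg₁ (q x) x ⟨hx, rfl⟩
    exact ⟨y, hy.1, hy.2, e⟩
  have e₂ : ∀ x ∈ S, ∃ y ∈ S, q y = q x ∧ d₂ x = c₂ y := fun x hx => by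
    obtain ⟨y, hy, e⟩ := hg₂ (q x) x ⟨hx, rfl⟩
    exact ⟨y, hy.1, hy.2, e⟩
  have hd : ∀ x ∈ S, ∀ y ∈ S, (d₁ x = d₁ y ↔ d₂ x = d₂ y) := by
    intro x hx y hy
    by_cases hq : q x = q y
    · have := hg (q x) x ⟨hx, rfl⟩ y ⟨hy, hq.symm⟩
      simpa only [d₁, d₂, ← hq] using this
    · obtain ⟨x₁, hx₁, qx₁, ex₁⟩ := e₁ x hx
      obtain ⟨y₁, hy₁, qy₁, ey₁⟩ := e₁ y hy
      obtain ⟨x₂, hx₂, qx₂, ex₂⟩ := e₂ x hx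
      obtain ⟨y₂, hy₂, qy₂, ey₂⟩ := e₂ y hy
      rw [ex₁, ey₁, ex₂, ey₂]
      exact iff_of_false
        (h₁ _ _ (.inr hx₁) (.inr hy₁) (hjoin _ hx₁ _ hy₁ (by rwa [qx₁, qy₁])))
        (h₂ _ _ (hSL _ hx₂) (hSL _ hy₂) (hjoin _ hx₂ _ hy₂ (by rwa [qx₂, qy₂])))
  have hpS : ∀ x ∈ S, ∀ y ∈ S, G.Adj x y → d₂ x ≠ d₂ y := by
    intro x hx y hy hxy
    by_cases hq : q x = q y
    · have := hp (q x) x ⟨hx, rfl⟩ y ⟨hy, hq.symm⟩ hxy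
      simpa only [d₂, ← hq] using this
    · obtain ⟨x₂, hx₂, qx₂, ex₂⟩ := e₂ x hx
      obtain ⟨y₂, hy₂, qy₂, ey₂⟩ := e₂ y hy
      rw [ex₂, ey₂]
      exact h₂ _ _ (hSL _ hx₂) (hSL _ hy₂) (hjoin _ hx₂ _ hy₂ (by rwa [qx₂, qy₂]))
  obtain ⟨p, hp⟩ : ∃ p : Equiv.Perm (Fin k), ∀ x ∈ S, p (d₁ x) = d₂ x := by
    have hr : ∀ i ∈ d₁ '' S, ∃ x ∈ S, d₁ x = i := fun i hi => hi
    let r : Fin k → Fin k := fun i => if hi : i ∈ d₁ '' S then d₂ (hr i hi).choose else i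
    have hrd : ∀ x ∈ S, r (d₁ x) = d₂ x := by
      intro x hx
      have hi : d₁ x ∈ d₁ '' S := ⟨x, hx, rfl⟩
      have hc := (hr _ hi).choose_spec
      simp only [r, dif_pos hi]
      exact (hd _ hc.1 _ hx).1 hc.2
    have hinj : Set.InjOn r (d₁ '' S) := by
      rintro _ ⟨x, hx, rfl⟩ _ ⟨y, hy, rfl⟩ h
      rw [hrd x hx, hrd y hy] at h
      exact (hd x hx y hy).2 h
    obtain ⟨g, hg⟩ := Set.MapsTo.exists_equiv_extend_of_card_eq (t := Finset.univ) (by simp)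
      (s := d₁ '' S) (f := r) (fun _ _ => by simp) hinj
    refine ⟨g.trans (Equiv.subtypeUnivEquiv (by simp)), fun x hx => ?_⟩
    rw [← hrd x hx]
    exact hg _ ⟨x, hx, rfl⟩
  have hSL' : ∀ x ∈ S, ∀ l ∈ L, G.Adj l x → d₂ x ≠ p (c₁ l) := by
    intro x hx l hl h e
    rw [← hp x hx, p.injective.eq_iff] at e
    obtain ⟨y, hy, hq, ey⟩ := e₁ x hx
    exact h₁ l y (.inl hl) (.inr hy)
      (hmod x y hq.symm l (fun h => hSL l h hl) h) (by rw [← e, ey])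
  have hSR : ∀ x ∈ S, ∀ r, r ∉ L → r ∉ S → G.Adj r x → d₂ x ≠ c₂ r := by
    intro x hx r hr hrS h e
    obtain ⟨y, hy, hq, ey⟩ := e₂ x hx
    exact h₂ r y hr (hSL y hy) (hmod x y hq.symm r hrS h) (by rw [← e, ey])
  let c : V → Fin k := fun v => if v ∈ S then d₂ v else if v ∈ L then p (c₁ v) else c₂ v
  refine ⟨SimpleGraph.Coloring.mk c fun {v w} hvw => ?_⟩
  have hwv := hvw.symm
  by_cases hv : v ∈ S <;> by_cases hw : w ∈ S
  · simpa [c, hv, hw] using hpS v hv w hw hvw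
  · by_cases hwL : w ∈ L
    · simpa [c, hv, hw, hwL] using hSL' v hv w hwL hwv
    · simpa [c, hv, hw, hwL] using hSR v hv w hwL hw hwv
  · by_cases hvL : v ∈ L
    · simpa [c, hv, hw, hvL] using (hSL' w hw v hvL hvw).symm
    · simpa [c, hv, hw, hvL] using (hSR w hw v hvL hv hvw).symm
  · by_cases hvL : v ∈ L <;> by_cases hwL : w ∈ L
    · simpa [c, hv, hw, hvL, hwL] using h₁ v w (.inl hvL) (.inl hwL) hvw
    · exact absurd hvw (hLR v hvL w hwL hw)
    · exact absurd hwv (hLR w hwL v hvL hv)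
    · simpa [c, hv, hw, hvL, hwL] using h₂ v w hvL hwL hvw

theorem noModuleSeparator_of_critical {V : Type*} [Finite V] (G : SimpleGraph V) {k : ℕ}
    (hG : ¬ G.Colorable k)
    (hcrit : ∀ v, ∃ c : V → Fin k, ∀ x y, x ≠ v → y ≠ v → G.Adj x y → c x ≠ c y) :
    NoModuleSeparator G := by
  rintro L S hLS ⟨l, hl⟩ ⟨r, hr, hrS⟩ hLR hS
  obtain ⟨c₁, h₁⟩ := hcrit r
  obtain ⟨c₂, h₂⟩ := hcrit l
  refine hG (exists_coloring_of_isModuleJoin G hLS hLR hS c₁ c₂ (fun x y hx hy => ?_)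
    (fun x y hx hy => ?_))
  · exact h₁ x y (by rintro rfl; tauto) (by rintro rfl; tauto)
  · exact h₂ x y (by rintro rfl; tauto) (by rintro rfl; tauto)

theorem adj_of_module {V : Type*} (G : SimpleGraph V) (hB : NoInducedBanner G)
    (hsep : NoModuleSeparator G) (hco : IsCoconnected G) {M : Set V} (hMu : Mᶜ.Nonempty)
    (hM : ∀ v ∉ M, ∀ x ∈ M, ∀ y ∈ M, G.Adj v x → G.Adj v y) {x y : V} (hx : x ∈ M) (hy : y ∈ M)
    (hxy : x ≠ y) : G.Adj x y := by
  by_contra hadj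
  obtain ⟨m, hm, r, hr, hmr⟩ := hco M ⟨x, hx⟩ hMu
  have hnr : ∀ r, r ∉ M → r ∉ {v | v ∉ M ∧ G.Adj v x} → ∀ l ∈ M, ¬ G.Adj l r :=
    fun r hr hrS l hl h => hrS ⟨hr, hM r hr l hl x hx h.symm⟩
  refine hsep M {v | v ∉ M ∧ G.Adj v x} (Set.disjoint_left.2 fun v h h' => h'.1 h) ⟨x, hx⟩
    ⟨r, hr, fun h => hmr (hM r hr x hx m hm h.2).symm⟩ (fun l hl r hr hrS => hnr r hr hrS l hl) ?_
  rintro p ⟨hp, hpx⟩ q ⟨hq, hqx⟩ _ hpq z hz hzp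
  by_cases hzM : z ∈ M
  · exact (hM q hq x hx z hzM hqx).symm
  · by_contra hzq
    exact hB x y p q z hpx (hM p hp x hx y hy hpx) hqx (hM q hq x hx y hy hqx) hxy hadj hpq
      hzp.symm (hnr z hzM hz x hx) (hnr z hzM hz y hy) (fun h => hzq h.symm)

/-- A separator between `A` and `B`, with `B` connected, that is complete to `A` and all of whose
vertices have a neighbour in `B`. -/
structure IsFullSeparation {V : Type*} (G : SimpleGraph V) (A S B : Set V) : Prop where
  nonempty_left : A.Nonempty
  nonempty_right : B.Nonempty
  cover : ∀ v, v ∈ A ∨ v ∈ S ∨ v ∈ B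
  disjoint_left : ∀ v ∈ A, v ∉ S
  disjoint_right : ∀ v ∈ B, v ∉ S
  disjoint_sides : ∀ v ∈ A, v ∉ B
  complete : ∀ a ∈ A, ∀ s ∈ S, G.Adj a s
  anticomplete : ∀ a ∈ A, ∀ b ∈ B, ¬ G.Adj a b
  exists_adj : ∀ s ∈ S, ∃ b ∈ B, G.Adj s b
  connected : ∀ T : Set V, (∃ t ∈ T, t ∈ B) → (∀ t ∈ T, t ∈ B → ∀ b ∈ B, G.Adj t b → b ∈ T) →
    ∀ b ∈ B, b ∈ T

/-- The subgraph of `G` on the vertices that are neither `z` nor adjacent to `z`. -/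
def farGraph {V : Type*} (G : SimpleGraph V) (z : V) : SimpleGraph V where
  Adj u w := G.Adj u w ∧ (¬ G.Adj z u ∧ u ≠ z) ∧ (¬ G.Adj z w ∧ w ≠ z)
  symm := ⟨fun _ _ h => ⟨h.1.symm, h.2.2, h.2.1⟩⟩
  loopless := ⟨fun _ h => G.loopless.irrefl _ h.1⟩

theorem far_of_reachable {V : Type*} {G : SimpleGraph V} {z b v : V} (hb : ¬ G.Adj z b ∧ b ≠ z)
    (h : (farGraph G z).Reachable b v) : ¬ G.Adj z v ∧ v ≠ z := by
  rw [SimpleGraph.reachable_iff_reflTransGen] at h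
  induction h with
  | refl => exact hb
  | tail _ h _ => exact h.2.2

theorem exists_isFullSeparation {V : Type*} [Finite V] (G : SimpleGraph V) {z b : V}
    (hzb : ¬ G.Adj z b ∧ b ≠ z) : ∃ A S B, IsFullSeparation G A S B := by
  generalize hn : {v | ¬ (farGraph G z).Reachable b v ∧
    ∀ u, (farGraph G z).Reachable b u → ¬ G.Adj u v}.ncard = n
  induction n using Nat.strong_induction_on generalizing z b with
  | _ n ih =>
  set B : Set V := {v | (farGraph G z).Reachable b v} with hB
  set A : Set V := {v | v ∉ B ∧ ∀ u ∈ B, ¬ G.Adj u v} with hA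
  set S : Set V := {v | v ∉ B ∧ ∃ u ∈ B, G.Adj u v} with hS
  have hfar : ∀ v ∈ B, ¬ G.Adj z v ∧ v ≠ z := fun v hv => far_of_reachable hzb hv
  have hstep : ∀ v ∈ B, ∀ w, G.Adj v w → ¬ G.Adj z w → w ≠ z → w ∈ B := fun v hv w hvw h h' =>
    SimpleGraph.Reachable.trans hv
      (SimpleGraph.Adj.reachable (G := farGraph G z) ⟨hvw, hfar v hv, h, h'⟩)
  have hbB : b ∈ B := SimpleGraph.Reachable.refl _
  have hzA : z ∈ A := ⟨fun h => (hfar z h).2 rfl, fun u hu h => (hfar u hu).1 h.symm⟩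
  have hSz : ∀ s ∈ S, G.Adj z s := by
    rintro s ⟨hs, u, hu, hus⟩
    by_contra h
    refine hs (hstep u hu s hus h ?_)
    rintro rfl
    exact (hfar u hu).1 hus.symm
  by_cases hc : ∀ a ∈ A, ∀ s ∈ S, G.Adj a s
  · refine ⟨A, S, B, ⟨z, hzA⟩, ⟨b, hbB⟩, fun v => ?_, fun v hv hvS => ?_, fun v hv hvS => hvS.1 hv,
      fun v hv => hv.1, hc, fun a ha u hu h => ha.2 u hu h.symm, ?_, ?_⟩
    · by_cases hv : v ∈ B
      · exact .inr (.inr hv)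
      · by_cases hu : ∃ u ∈ B, G.Adj u v
        · exact .inr (.inl ⟨hv, hu⟩)
        · exact .inl ⟨hv, fun u h h' => hu ⟨u, h, h'⟩⟩
    · obtain ⟨_, u, hu, h⟩ := hvS
      exact hv.2 u hu h
    · rintro s ⟨_, u, hu, h⟩
      exact ⟨u, hu, h.symm⟩
    · rintro T ⟨t, ht, htB⟩ hT v hv
      have h : (farGraph G z).Reachable t v :=
        SimpleGraph.Reachable.trans (SimpleGraph.Reachable.symm htB) hv
      rw [SimpleGraph.reachable_iff_reflTransGen] at h
      have key : v ∈ T ∧ v ∈ B := by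
        clear hv
        induction h with
        | refl => exact ⟨ht, htB⟩
        | tail _ h ih' =>
          have := hstep _ ih'.2 _ h.1 h.2.2.1 h.2.2.2
          exact ⟨hT _ ih'.1 ih'.2 _ this h.1, this⟩
      exact key.1
  · push Not at hc
    obtain ⟨w, hw, y, hy, hwy⟩ := hc
    have hwy' : ¬ G.Adj w y ∧ y ≠ w := by
      refine ⟨hwy, ?_⟩
      rintro rfl
      obtain ⟨_, u, hu, h⟩ := hy
      exact hw.2 u hu h
    set B' : Set V := {v | (farGraph G w).Reachable y v} with hB'
    have hyB' : y ∈ B' := SimpleGraph.Reachable.refl _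
    have hfar' : ∀ v ∈ B', ¬ G.Adj w v ∧ v ≠ w := fun v hv => far_of_reachable hwy' hv
    have hstep' : ∀ v ∈ B', ∀ u, G.Adj v u → ¬ G.Adj w u → u ≠ w → u ∈ B' := fun v hv u hvu h h' =>
      SimpleGraph.Reachable.trans hv
        (SimpleGraph.Adj.reachable (G := farGraph G w) ⟨hvu, hfar' v hv, h, h'⟩)
    have hwB : ∀ u ∈ B, ¬ G.Adj w u ∧ u ≠ w := fun u hu =>
      ⟨fun h => hw.2 u hu h.symm, fun h => hw.1 (h ▸ hu)⟩
    have hBB' : B ⊆ B' := by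
      obtain ⟨_, u, hu, huy⟩ := hy
      have huB' : u ∈ B' := hstep' y hyB' u huy.symm (hwB u hu).1 (hwB u hu).2
      intro v hv
      have h : (farGraph G z).Reachable u v :=
        SimpleGraph.Reachable.trans (SimpleGraph.Reachable.symm hu) hv
      rw [SimpleGraph.reachable_iff_reflTransGen] at h
      have key : v ∈ B ∧ v ∈ B' := by
        clear hv
        induction h with
        | refl => exact ⟨hu, huB'⟩
        | tail _ h ih' =>
          have := hstep _ ih'.1 _ h.1 h.2.2.1 h.2.2.2
          exact ⟨this, hstep' _ ih'.2 _ h.1 (hwB _ this).1 (hwB _ this).2⟩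
      exact key.2
    refine ih _ ?_ hwy' rfl
    rw [← hn]
    refine Set.ncard_lt_ncard ?_ (Set.toFinite _)
    rw [Set.ssubset_iff_of_subset]
    · exact ⟨z, hzA, fun h => h.2 y hyB' (hSz y hy).symm⟩
    · rintro v ⟨hv, hvB'⟩
      exact ⟨fun h => hv (hBB' h), fun u hu => hvB' u (hBB' hu)⟩

namespace IsFullSeparation

variable {V : Type*} {G : SimpleGraph V} {A S B : Set V}

theorem adj_or_adj (hF : IsFullSeparation G A S B) (hP : NoInducedP5 G) (hB : NoInducedBanner G)
    {x y : V} (hx : x ∈ S) (hy : y ∈ S) (hxy : x ≠ y) (nxy : ¬ G.Adj x y) :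
    ∀ b ∈ B, G.Adj b x ∨ G.Adj b y := by
  obtain ⟨a, ha⟩ := hF.nonempty_left
  refine hF.connected {b | G.Adj b x ∨ G.Adj b y} ?_ ?_
  · obtain ⟨b, hb, h⟩ := hF.exists_adj x hx
    exact ⟨b, .inl h.symm, hb⟩
  · intro t ht htB b hb htb
    by_contra hn
    simp only [Set.mem_ofPred_eq, not_or] at hn ht
    have := hF.complete a ha x hx
    have := hF.complete a ha y hy
    have := hF.anticomplete a ha t htB
    have := hF.anticomplete a ha b hb
    by_cases htx : G.Adj t x <;> by_cases hty : G.Adj t y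
    · apply hB x y t a b <;> grind [G.adj_comm]
    · apply hP b t x a y <;> grind [G.adj_comm]
    · apply hP b t y a x <;> grind [G.adj_comm]
    · tauto

/-- A vertex of the separator that distinguishes nonadjacent vertices of `B` is adjacent to the
rest of the separator. -/
theorem adj_of_distinguishes (hF : IsFullSeparation G A S B) (hP : NoInducedP5 G)
    (hB : NoInducedBanner G) {s t u v : V} (hs : s ∈ S) (ht : t ∈ S) (hst : s ≠ t) (hu : u ∈ B)
    (hv : v ∈ B) (huv : ¬ G.Adj u v) (hsu : G.Adj s u) (hsv : ¬ G.Adj s v) : G.Adj s t := by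
  obtain ⟨a, ha⟩ := hF.nonempty_left
  by_contra nst
  have has := hF.complete a ha s hs
  have hat := hF.complete a ha t ht
  have hau := hF.anticomplete a ha u hu
  have hav := hF.anticomplete a ha v hv
  have hvt : G.Adj v t :=
    (hF.adj_or_adj hP hB hs ht hst nst v hv).resolve_left fun h => hsv h.symm
  by_cases htu : G.Adj t u
  · exact hB a u t s v hat.symm htu has.symm hsu (fun e => hF.disjoint_sides a ha (e ▸ hu)) hau
      (fun h => nst h.symm) hvt.symm hav huv hsv
  · exact hP u s a t v hsu.symm has.symm hat hvt.symm (fun h => hau h.symm) (fun h => htu h.symm)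
      huv nst hsv hav

theorem adj_right (hF : IsFullSeparation G A S B) (hP : NoInducedP5 G) (hB : NoInducedBanner G)
    (hsep : NoModuleSeparator G) {u₀ v₀ : V} (hu₀ : u₀ ∈ B) (hv₀ : v₀ ∈ B) (h₀ : u₀ ≠ v₀) :
    G.Adj u₀ v₀ := by
  by_contra nadj₀
  obtain ⟨a, ha⟩ := hF.nonempty_left
  -- The component of `u₀` in the complement of `G[B]`.
  let M : Set V := {m | Relation.ReflTransGen (fun b c => c ∈ B ∧ b ≠ c ∧ ¬ G.Adj b c) u₀ m}
  have hMB : ∀ m ∈ M, m ∈ B := by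
    intro m hm
    induction hm with
    | refl => exact hu₀
    | tail _ h _ => exact h.1
  have huM : u₀ ∈ M := .refl
  have hvM : v₀ ∈ M := .single ⟨hv₀, h₀, nadj₀⟩
  have hMadj : ∀ b ∈ B, b ∉ M → ∀ m ∈ M, G.Adj b m := by
    intro b hb hbM m hm
    by_contra h
    exact hbM (.tail hm ⟨hb, fun e => hbM (e ▸ hm), fun h' => h h'.symm⟩)
  have hmixed : ∀ s, ∀ m ∈ M, ∀ m' ∈ M, G.Adj s m → ¬ G.Adj s m' →
      ∃ u ∈ B, ∃ v ∈ B, u ∈ M ∧ v ∈ M ∧ ¬ G.Adj u v ∧ G.Adj s u ∧ ¬ G.Adj s v := by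
    intro s m hm m' hm' h h'
    by_contra hn
    have key : ∀ w ∈ M, (G.Adj s w ↔ G.Adj s u₀) := by
      intro w hw
      induction hw with
      | refl => exact Iff.rfl
      | @tail b c hb hc ih =>
        rw [← ih]
        have hb' : b ∈ M := hb
        have hc' : c ∈ M := .tail hb hc
        constructor <;> intro hs <;> by_contra hs'
        · exact hn ⟨c, hc.1, b, hMB b hb', hc', hb', fun e => hc.2.2 e.symm, hs, hs'⟩
        · exact hn ⟨b, hMB b hb', c, hc.1, hb', hc', hc.2.2, hs, hs'⟩
    exact h' ((key m' hm').2 ((key m hm).1 h))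
  let T : Set V := {t | t ∉ M ∧ ∃ m ∈ M, G.Adj t m}
  have hAT : ∀ t ∈ T, t ∉ A := fun t ht h =>
    let ⟨m, hm, hm'⟩ := ht.2
    hF.anticomplete t h m (hMB m hm) hm'
  have hcomplete : ∀ p ∈ T, ∀ q ∈ T, p ≠ q → ¬ G.Adj p q → ∀ m ∈ M, G.Adj p m := by
    intro p hp q hq hpq npq m hm
    rcases hF.cover p with h | hpS | hpB
    · exact absurd h (hAT p hp)
    · by_contra hpm
      obtain ⟨m', hm', hpm'⟩ := hp.2
      obtain ⟨u, hu, v, hv, huM, hvM, huv, hpu, hpv⟩ := hmixed p m' hm' m hm hpm' hpm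
      rcases hF.cover q with h | hqS | hqB
      · exact hAT q hq h
      · exact npq (hF.adj_of_distinguishes hP hB hpS hqS hpq hu hv huv hpu hpv)
      · exact hP v q u p a (hMadj q hqB hq.1 v hvM).symm (hMadj q hqB hq.1 u huM) hpu.symm
          (hF.complete a ha p hpS).symm (fun h => huv h.symm) (fun h => hpv h.symm)
          (fun h => hF.anticomplete a ha v hv h.symm) (fun h => npq h.symm)
          (fun h => hF.anticomplete a ha q hqB h.symm) (fun h => hF.anticomplete a ha u hu h.symm)
    · exact hMadj p hpB hp.1 m hm
  refine hsep M T (Set.disjoint_left.2 fun m hm h => h.1 hm) ⟨u₀, huM⟩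
    ⟨a, fun h => hF.disjoint_sides a ha (hMB a h), fun h => hAT a h ha⟩
    (fun l hl r hr hrT h => hrT ⟨hr, l, hl, h.symm⟩) ?_
  intro p hp q hq hpq npq z hz hzp
  have hpM := hcomplete p hp q hq hpq npq
  have hqM := hcomplete q hq p hp hpq.symm fun h => npq h.symm
  by_cases hzM : z ∈ M
  · exact (hqM z hzM).symm
  · by_contra hzq
    have hzu : ∀ m ∈ M, ¬ G.Adj m z := fun m hm h => hz ⟨hzM, m, hm, h.symm⟩
    exact hB u₀ v₀ p q z (hpM _ huM) (hpM _ hvM) (hqM _ huM) (hqM _ hvM) h₀ nadj₀ npq hzp.symm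
      (hzu _ huM) (hzu _ hvM) (fun h => hzq h.symm)

theorem adj_left (hF : IsFullSeparation G A S B) (hB : NoInducedBanner G)
    (hsep : NoModuleSeparator G) (hco : IsCoconnected G) {x y : V} (hx : x ∈ A) (hy : y ∈ A)
    (hxy : x ≠ y) : G.Adj x y := by
  obtain ⟨b, hb⟩ := hF.nonempty_right
  refine adj_of_module G hB hsep hco ⟨b, fun h => hF.disjoint_sides _ h hb⟩ ?_ hx hy hxy
  intro v hv x hx y hy hvx
  rcases hF.cover v with h | h | h
  · exact absurd h hv
  · exact (hF.complete y hy v h).symm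
  · exact absurd hvx.symm (hF.anticomplete x hx v h)

/-- No three vertices of the separator are pairwise nonadjacent. -/
theorem not_indepTriple (hF : IsFullSeparation G A S B) (hP : NoInducedP5 G)
    (hB : NoInducedBanner G) (hsep : NoModuleSeparator G) (hco : IsCoconnected G) {p q r : V}
    (hp : p ∈ S) (hq : q ∈ S) (hr : r ∈ S) (hpq : p ≠ q) (hpr : p ≠ r) (hqr : q ≠ r)
    (npq : ¬ G.Adj p q) (npr : ¬ G.Adj p r) (nqr : ¬ G.Adj q r) : False := by
  obtain ⟨a, ha⟩ := hF.nonempty_left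
  have hdom : ∀ x ∈ S, ∀ y ∈ S, x ≠ y → ¬ G.Adj x y → ∀ b ∈ B, G.Adj b x ∨ G.Adj b y :=
    fun x hx y hy => hF.adj_or_adj hP hB hx hy
  let Indep : V → V → V → Prop := fun x y z => x ∈ S ∧ y ∈ S ∧ z ∈ S ∧ x ≠ y ∧ x ≠ z ∧ y ≠ z ∧
    ¬ G.Adj x y ∧ ¬ G.Adj x z ∧ ¬ G.Adj y z
  have hBtriple : ∀ b ∈ B, ∀ x y z, Indep x y z → G.Adj b x := by
    rintro b hb x y z ⟨hx, hy, hz, hxy, hxz, hyz, nxy, nxz, nyz⟩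
    by_contra hbx
    have hby := (hdom x hx y hy hxy nxy b hb).resolve_left hbx
    have hbz := (hdom x hx z hz hxz nxz b hb).resolve_left hbx
    exact hB y z a b x (hF.complete a ha y hy) (hF.complete a ha z hz) hby hbz hyz nyz
      (hF.anticomplete a ha b hb) (hF.complete a ha x hx) (fun h => nxy h.symm)
      (fun h => nxz h.symm) hbx
  let M : Set V := {x | x ∈ S ∧ ∃ u t₂ t₃, Indep u t₂ t₃ ∧ (x = u ∨ ¬ G.Adj x u)}
  -- A vertex of `M` is in an independent triple, or adjacent to two vertices of one.
  have hMcases : ∀ x ∈ M, (∃ t₂ t₃, Indep x t₂ t₃) ∨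
      ∃ u t₂ t₃, Indep u t₂ t₃ ∧ ¬ G.Adj x u ∧ G.Adj x t₂ ∧ G.Adj x t₃ := by
    rintro x ⟨hx, u, t₂, t₃, ht, hxu⟩
    clear hdom hBtriple hpq hpr hqr npq npr nqr hp hq hr
    by_cases e : x = u
    · exact .inl ⟨t₂, t₃, e ▸ ht⟩
    by_cases e₂ : x = t₂
    · exact .inl ⟨u, t₃, by grind [G.adj_comm]⟩
    by_cases e₃ : x = t₃
    · exact .inl ⟨u, t₂, by grind [G.adj_comm]⟩
    replace hxu := hxu.resolve_left e
    by_cases h2 : G.Adj x t₂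
    · by_cases h3 : G.Adj x t₃
      · exact .inr ⟨u, t₂, t₃, ht, hxu, h2, h3⟩
      · exact .inl ⟨u, t₃, by grind⟩
    · exact .inl ⟨u, t₂, by grind⟩
  have hMB : ∀ b ∈ B, ∀ x ∈ M, G.Adj b x := by
    intro b hb x hxM
    rcases hMcases x hxM with ⟨t₂, t₃, ht⟩ | ⟨u, t₂, t₃, ht, hxu, h2, h3⟩
    · exact hBtriple b hb x t₂ t₃ ht
    · by_contra hbx
      have hu := hBtriple b hb u t₂ t₃ ht
      have ht2 : G.Adj b t₂ := hBtriple b hb t₂ u t₃ (by grind [G.adj_comm])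
      have ht3 : G.Adj b t₃ := hBtriple b hb t₃ u t₂ (by grind [G.adj_comm])
      obtain ⟨-, -, -, -, -, h23, n12, n13, n23⟩ := ht
      exact hB t₂ t₃ b x u ht2 ht3 h2 h3 h23 n23 hbx hu (fun h => n12 h.symm)
        (fun h => n13 h.symm) hxu
  have hMS : ∀ y ∈ S, y ∉ M → ∀ x ∈ M, G.Adj y x := by
    intro y hy hyM x hxM
    by_contra nyx
    rcases hMcases x hxM with ⟨t₂, t₃, ht⟩ | ⟨u, t₂, t₃, ht, hxu, h2, h3⟩
    · exact hyM ⟨hy, x, t₂, t₃, ht, .inr nyx⟩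
    · have hyu : G.Adj y u := by
        by_contra h
        exact hyM ⟨hy, u, t₂, t₃, ht, .inr h⟩
      have hy2 : G.Adj y t₂ := by
        by_contra h
        exact hyM ⟨hy, t₂, u, t₃, by grind [G.adj_comm], .inr h⟩
      have hy3 : G.Adj y t₃ := by
        by_contra h
        exact hyM ⟨hy, t₃, u, t₂, by grind [G.adj_comm], .inr h⟩
      obtain ⟨-, -, -, -, -, h23, n12, n13, n23⟩ := ht
      exact hB t₂ t₃ y x u hy2 hy3 h2 h3 h23 n23 nyx hyu (fun h => n12 h.symm)
        (fun h => n13 h.symm) hxu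
  have haM : a ∉ M := fun h => hF.disjoint_left a ha h.1
  have hmem : ∀ x y z, Indep x y z → x ∈ M := fun x y z h => ⟨h.1, x, y, z, h, .inl rfl⟩
  refine npq (adj_of_module G hB hsep hco ⟨a, haM⟩ ?_ (hmem p q r ?_) (hmem q p r ?_) hpq)
  · intro v hv x hx y hy _
    rcases hF.cover v with h | h | h
    · exact hF.complete v h y hy.1
    · exact hMS v h hv y hy
    · exact hMB v h y hy
  · grind
  · grind [G.adj_comm]

end IsFullSeparation

theorem noIndepTriple_of_noModuleSeparator {V : Type*} [Finite V] (G : SimpleGraph V)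
    (hP : NoInducedP5 G) (hB : NoInducedBanner G) (hsep : NoModuleSeparator G)
    (hco : IsCoconnected G) : NoIndepTriple G := by
  intro p q r hpq hpr hqr npq npr nqr
  obtain ⟨A, S, B, hF⟩ := exists_isFullSeparation G (z := p) (b := q) ⟨npq, hpq.symm⟩
  have nqp : ¬ G.Adj q p := fun h => npq h.symm
  have nrp : ¬ G.Adj r p := fun h => npr h.symm
  have nrq : ¬ G.Adj r q := fun h => nqr h.symm
  have hAA : ∀ x y, x ≠ y → ¬ G.Adj x y → x ∈ A → y ∉ A := fun x y h n hx hy =>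
    n (hF.adj_left hB hsep hco hx hy h)
  have hBB : ∀ x y, x ≠ y → ¬ G.Adj x y → x ∈ B → y ∉ B := fun x y h n hx hy =>
    n (hF.adj_right hP hB hsep hx hy h)
  have hAS : ∀ x y, ¬ G.Adj x y → x ∈ A → y ∉ S := fun x y n hx hy => n (hF.complete x hx y hy)
  have hBSS : ∀ x y z, y ≠ z → ¬ G.Adj y z → ¬ G.Adj x y → ¬ G.Adj x z → x ∈ B → y ∈ S →
      z ∉ S := fun x y z hyz nyz nxy nxz hx hy hz =>
    (hF.adj_or_adj hP hB hy hz hyz nyz x hx).elim nxy nxz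
  have hSSS : p ∈ S → q ∈ S → r ∉ S := fun hp hq hr =>
    hF.not_indepTriple hP hB hsep hco hp hq hr hpq hpr hqr npq npr nqr
  have hp := hF.cover p
  have hq := hF.cover q
  have hr := hF.cover r
  have := hpq.symm
  have := hpr.symm
  have := hqr.symm
  rcases hp with hp | hp | hp <;> rcases hq with hq | hq | hq <;> rcases hr with hr | hr | hr <;>
    grind

/-- Passing from `G` to `H` creates no larger cliques and does not decrease the chromatic
number. -/
structure IsReduct {V W : Type*} (G : SimpleGraph V) (H : SimpleGraph W) : Prop where
  cliqueFree : ∀ n, G.CliqueFree n → H.CliqueFree n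
  colorable : ∀ k, H.Colorable k → G.Colorable k

section joinGraph

variable {V W : Type*} {G : SimpleGraph V} {H : SimpleGraph W}

@[simp] theorem joinGraph_adj_inl_inl {u v : V} :
    (joinGraph G H).Adj (.inl u) (.inl v) ↔ G.Adj u v := by
  simp only [joinGraph, SimpleGraph.fromRel_adj]
  grind [G.adj_comm, G.ne_of_adj]

@[simp] theorem joinGraph_adj_inr_inr {u v : W} :
    (joinGraph G H).Adj (.inr u) (.inr v) ↔ H.Adj u v := by
  simp only [joinGraph, SimpleGraph.fromRel_adj]
  grind [H.adj_comm, H.ne_of_adj]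

@[simp] theorem joinGraph_adj_inl_inr {u : V} {v : W} :
    (joinGraph G H).Adj (.inl u) (.inr v) := by
  simp [joinGraph]

@[simp] theorem joinGraph_adj_inr_inl {u : V} {v : W} :
    (joinGraph G H).Adj (.inr v) (.inl u) := joinGraph_adj_inl_inr.symm

theorem NoIndepTriple.join (hG : NoIndepTriple G) (hH : NoIndepTriple H) :
    NoIndepTriple (joinGraph G H) := by
  rintro (a | a) (b | b) (c | c) hab hac hbc nab nac nbc <;>
    simp_all only [joinGraph_adj_inl_inl, joinGraph_adj_inr_inr, joinGraph_adj_inl_inr,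
      joinGraph_adj_inr_inl, not_true_eq_false, ne_eq, Sum.inl.injEq, Sum.inr.injEq]
  · exact hG a b c hab hac hbc nab nac nbc
  · exact hH a b c hab hac hbc nab nac nbc

theorem isClique_toLeft {s : Finset (V ⊕ W)} (hs : (joinGraph G H).IsClique s) :
    G.IsClique (s.toLeft : Set V) := fun u hu v hv huv =>
  joinGraph_adj_inl_inl.1 (hs (by simpa using hu) (by simpa using hv) (by simpa using huv))

theorem isClique_toRight {s : Finset (V ⊕ W)} (hs : (joinGraph G H).IsClique s) :
    H.IsClique (s.toRight : Set W) := fun u hu v hv huv =>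
  joinGraph_adj_inr_inr.1 (hs (by simpa using hu) (by simpa using hv) (by simpa using huv))

theorem isClique_disjSum {s : Finset V} {t : Finset W} (hs : G.IsClique s) (ht : H.IsClique t) :
    (joinGraph G H).IsClique (s.disjSum t) := by
  rintro (u | u) hu (v | v) hv huv
  · exact joinGraph_adj_inl_inl.2 (hs (by simpa using hu) (by simpa using hv) (by simpa using huv))
  · exact joinGraph_adj_inl_inr
  · exact joinGraph_adj_inr_inl
  · exact joinGraph_adj_inr_inr.2 (ht (by simpa using hu) (by simpa using hv) (by simpa using huv))

end joinGraph

theorem IsReduct.join_of_induce {V W₁ W₂ : Type*} {G : SimpleGraph V} {P : Set V}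
    {H₁ : SimpleGraph W₁} {H₂ : SimpleGraph W₂} (hP : ∀ p ∈ P, ∀ q ∉ P, G.Adj p q)
    (h₁ : IsReduct (G.induce P) H₁) (h₂ : IsReduct (G.induce Pᶜ) H₂) :
    IsReduct G (joinGraph H₁ H₂) := by
  classical
  constructor
  · intro n hn s hs
    have hl : ¬ (G.induce P).CliqueFree s.toLeft.card := fun h =>
      h₁.cliqueFree _ h s.toLeft ⟨isClique_toLeft hs.isClique, rfl⟩
    have hr : ¬ (G.induce Pᶜ).CliqueFree s.toRight.card := fun h =>
      h₂.cliqueFree _ h s.toRight ⟨isClique_toRight hs.isClique, rfl⟩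
    simp only [SimpleGraph.CliqueFree, not_forall, not_not] at hl hr
    obtain ⟨t, ht⟩ := hl
    obtain ⟨u, hu⟩ := hr
    have hd : Disjoint (t.map (.subtype _)) (u.map (.subtype _)) := by
      rw [Finset.disjoint_left]
      intro x hx hx'
      simp only [Finset.mem_map, Function.Embedding.subtype_apply, Subtype.exists] at hx hx'
      obtain ⟨y, hy, -, rfl⟩ := hx
      obtain ⟨z, hz, -, rfl⟩ := hx'
      exact hz hy
    refine hn (t.map (.subtype _) ∪ u.map (.subtype _)) ⟨?_, ?_⟩
    · intro x hx y hy hxy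
      simp only [Finset.coe_union, Finset.coe_map, Function.Embedding.subtype_apply, Set.mem_union,
        Set.mem_image, Finset.mem_coe, Subtype.exists, exists_and_right, exists_eq_right] at hx hy
      rcases hx with ⟨hxP, hx⟩ | ⟨hxP, hx⟩ <;> rcases hy with ⟨hyP, hy⟩ | ⟨hyP, hy⟩
      · exact ht.isClique hx hy (by simpa using hxy)
      · exact hP x hxP y hyP
      · exact (hP y hyP x hxP).symm
      · exact hu.isClique hx hy (by simpa using hxy)
    · rw [Finset.card_union_of_disjoint hd, Finset.card_map, Finset.card_map, ht.card_eq,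
        hu.card_eq, Finset.card_toLeft_add_card_toRight, hs.card_eq]
  · rintro k ⟨c⟩
    let I : Set (Fin k) := Set.range (c ∘ Sum.inl)
    let J : Set (Fin k) := Set.range (c ∘ Sum.inr)
    have hIJ : ∀ i ∈ I, i ∉ J := by
      rintro _ ⟨u, rfl⟩ ⟨v, e⟩
      exact c.valid joinGraph_adj_inr_inl e
    let c₁ : H₁.Coloring I := SimpleGraph.Coloring.mk (fun u => ⟨c (.inl u), u, rfl⟩)
      fun h e => c.valid (joinGraph_adj_inl_inl.2 h) (congrArg Subtype.val e)
    let c₂ : H₂.Coloring J := SimpleGraph.Coloring.mk (fun u => ⟨c (.inr u), u, rfl⟩)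
      fun h e => c.valid (joinGraph_adj_inr_inr.2 h) (congrArg Subtype.val e)
    let d₁ : (G.induce P).Coloring I := (h₁.colorable _ c₁.colorable).toColoring le_rfl
    let d₂ : (G.induce Pᶜ).Coloring J := (h₂.colorable _ c₂.colorable).toColoring le_rfl
    refine ⟨SimpleGraph.Coloring.mk
      (fun v => if hv : v ∈ P then (d₁ ⟨v, hv⟩ : Fin k) else d₂ ⟨v, hv⟩) fun {v w} hvw => ?_⟩
    by_cases hv : v ∈ P <;> by_cases hw : w ∈ P <;> simp only [hv, hw, dif_pos, dite_false]
    · exact fun e => d₁.valid (v := ⟨v, hv⟩) (w := ⟨w, hw⟩) hvw (Subtype.ext e)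
    · exact fun e => hIJ _ (d₁ ⟨v, hv⟩).2 (e ▸ (d₂ ⟨w, hw⟩).2)
    · exact fun e => hIJ _ (d₁ ⟨w, hw⟩).2 (e ▸ (d₂ ⟨v, hv⟩).2)
    · exact fun e => d₂.valid (v := ⟨v, hv⟩) (w := ⟨w, hw⟩) hvw (Subtype.ext e)

theorem exists_isReduct {V : Type} [Finite V] (G : SimpleGraph V) (hP : NoInducedP5 G)
    (hB : NoInducedBanner G) :
    ∃ (W : Type) (_ : Finite W) (H : SimpleGraph W), NoIndepTriple H ∧ IsReduct G H := by
  generalize hn : Nat.card V = n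
  induction n using Nat.strong_induction_on generalizing V with
  | _ n ih =>
  subst hn
  have hself : NoIndepTriple G →
      ∃ (W : Type) (_ : Finite W) (H : SimpleGraph W), NoIndepTriple H ∧ IsReduct G H :=
    fun h => ⟨V, inferInstance, G, h, fun _ => id, fun _ => id⟩
  have hind : ∀ P : Set V, Pᶜ.Nonempty → ∃ (W : Type) (_ : Finite W) (H : SimpleGraph W),
      NoIndepTriple H ∧ IsReduct (G.induce P) H := by
    rintro P ⟨v, hv⟩
    refine ih _ ?_ (G.induce P) (fun a b c d e => hP a b c d e) (fun a b x y z h₁ h₂ h₃ h₄ hab =>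
      hB a b x y z h₁ h₂ h₃ h₄ (Subtype.coe_injective.ne hab)) rfl
    exact Finite.card_subtype_lt hv
  rcases subsingleton_or_nontrivial V with hV | hV
  · exact hself fun a b _ hab => absurd (Subsingleton.elim a b) hab
  by_cases hco : IsCoconnected G
  · obtain ⟨k, hk, hk'⟩ : ∃ k, G.Colorable (k + 1) ∧ ¬ G.Colorable k := by
      classical
      have hex : ∃ m, G.Colorable m := by
        have := Fintype.ofFinite V
        exact ⟨_, G.colorable_of_fintype⟩
      obtain ⟨k, hk⟩ : ∃ k, Nat.find hex = k + 1 := by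
        refine Nat.exists_eq_succ_of_ne_zero fun h => ?_
        have h0 := Nat.find_spec hex
        rw [h] at h0
        obtain ⟨c⟩ := h0
        obtain ⟨v⟩ := hV.to_nonempty
        exact (c v).elim0
      exact ⟨k, hk ▸ Nat.find_spec hex, Nat.find_min hex (by omega)⟩
    by_cases hcrit : ∀ v, (G.induce {v}ᶜ).Colorable k
    · refine hself (noIndepTriple_of_noModuleSeparator G hP hB
        (noModuleSeparator_of_critical G hk' fun v => ?_) hco)
      classical
      obtain ⟨c⟩ := hcrit v
      obtain ⟨w, hw⟩ := exists_ne v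
      refine ⟨fun x => if hx : x = v then c ⟨w, hw⟩ else c ⟨x, hx⟩, fun x y hx hy hxy => ?_⟩
      simp only [hx, hy, dite_false]
      exact c.valid (v := ⟨x, hx⟩) (w := ⟨y, hy⟩) hxy
    · push Not at hcrit
      obtain ⟨v, hv⟩ := hcrit
      obtain ⟨W, hW, H, hH, hr⟩ := hind {v}ᶜ ⟨v, by simp⟩
      refine ⟨W, hW, H, hH, fun n hn => hr.cliqueFree n ?_, fun j hj => ?_⟩
      · exact hn.comap ⟨(SimpleGraph.Embedding.induce _).toCopy⟩
      · refine hk.mono (Nat.succ_le_of_lt (lt_of_not_ge fun h => hv ?_))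
        exact (hr.colorable j hj).mono h
  · simp only [IsCoconnected] at hco
    push Not at hco
    obtain ⟨P, hP₁, hP₂, hPP⟩ := hco
    obtain ⟨W₁, _, H₁, hH₁, hr₁⟩ := hind P hP₂
    obtain ⟨W₂, _, H₂, hH₂, hr₂⟩ := hind Pᶜ (by rwa [compl_compl])
    exact ⟨W₁ ⊕ W₂, inferInstance, joinGraph H₁ H₂, hH₁.join hH₂, hr₁.join_of_induce hPP hr₂⟩

theorem indFree_iff {α β : Type*} {H : SimpleGraph α} {G : SimpleGraph β} :
    IndFree H G ↔ IsEmpty (H ↪g G) :=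
  ⟨fun h => ⟨fun f => h _ ⟨f.isoInduceRange⟩⟩, fun h s ⟨f⟩ =>
    h.elim ((SimpleGraph.Embedding.induce s).comp f.toEmbedding)⟩

theorem IndFree.of_embedding {α β γ : Type*} {H : SimpleGraph α} {K : SimpleGraph β}
    {G : SimpleGraph γ} (h : IndFree H G) (f : H ↪g K) : IndFree K G :=
  indFree_iff.2 ⟨fun g => (indFree_iff.1 h).elim (g.comp f)⟩

theorem IndFree.not_embedding {α β : Type*} {H : SimpleGraph α} {G : SimpleGraph β}
    (h : IndFree H G) (f : α → β) (hinj : Function.Injective f)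
    (hf : ∀ i j, G.Adj (f i) (f j) ↔ H.Adj i j) : False :=
  (indFree_iff.1 h).elim ⟨⟨f, hinj⟩, fun {i j} => hf i j⟩

theorem NoInducedP5.of_indFree {V : Type*} {G : SimpleGraph V} (h : IndFree (pathGraph 5) G) :
    NoInducedP5 G := by
  intro a b c d e hab hbc hcd hde nac nad nae nbd nbe nce
  refine h.not_embedding ![a, b, c, d, e] ?_ ?_
  · intro i j hij
    fin_cases i <;> fin_cases j <;> simp at hij ⊢ <;> subst hij <;> simp_all [G.adj_comm]
  · intro i j
    fin_cases i <;> fin_cases j <;> simp_all [SimpleGraph.pathGraph_adj, G.adj_comm]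

theorem NoInducedBanner.of_indFree {V : Type*} {G : SimpleGraph V} (h : IndFree banner G) :
    NoInducedBanner G := by
  intro a b x y z hxa hxb hya hyb hab nab nxy hxz naz nbz nyz
  refine h.not_embedding ![x, a, y, b, z] ?_ ?_
  · intro i j hij
    fin_cases i <;> fin_cases j <;> simp at hij ⊢ <;> subst hij <;> simp_all [G.adj_comm]
  · intro i j
    fin_cases i <;> fin_cases j <;> simp_all [banner, G.adj_comm]

theorem indFree_threeK1_iff {V : Type*} {G : SimpleGraph V} :
    IndFree threeK1 G ↔ NoIndepTriple G := by
  constructor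
  · intro h a b c hab hac hbc nab nac nbc
    refine h.not_embedding ![a, b, c] ?_ ?_
    · intro i j hij
      fin_cases i <;> fin_cases j <;> simp_all
    · intro i j
      fin_cases i <;> fin_cases j <;> simp_all [threeK1, G.adj_comm]
  · intro h
    refine indFree_iff.2 ⟨fun f => ?_⟩
    have hadj : ∀ i j, ¬ G.Adj (f i) (f j) := fun i j => f.map_adj_iff.not.2 (by simp [threeK1])
    exact h (f 0) (f 1) (f 2) (f.injective.ne (by decide)) (f.injective.ne (by decide))
      (f.injective.ne (by decide)) (hadj _ _) (hadj _ _) (hadj _ _)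

/-- The vertices `0`, `2`, `4` of the path are pairwise nonadjacent. -/
def threeK1EmbeddingPathGraph : threeK1 ↪g pathGraph 5 where
  toFun := ![0, 2, 4]
  inj' := by decide
  map_rel_iff' {i j} := by
    fin_cases i <;> fin_cases j <;> simp [threeK1, SimpleGraph.pathGraph_adj]

/-- The vertices `1`, `3`, `4` of the banner are pairwise nonadjacent. -/
def threeK1EmbeddingBanner : threeK1 ↪g banner where
  toFun := ![1, 3, 4]
  inj' := by decide
  map_rel_iff' {i j} := by
    fin_cases i <;> fin_cases j <;> simp [threeK1, banner]

theorem NoIndepTriple.of_embedding {V W : Type*} {G : SimpleGraph V} {H : SimpleGraph W}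
    (h : NoIndepTriple H) (f : G ↪g H) : NoIndepTriple G := by
  intro a b c hab hac hbc
  simpa using h (f a) (f b) (f c) (f.injective.ne hab) (f.injective.ne hac) (f.injective.ne hbc)

theorem cliqueNum_eq_iff {V : Type*} [Finite V] {G : SimpleGraph V} {n : ℕ} :
    G.cliqueNum = n ↔ ¬ G.CliqueFree n ∧ G.CliqueFree (n + 1) := by
  have hle : ∀ m, ¬ G.CliqueFree m → m ≤ G.cliqueNum := by
    intro m hm
    simp only [SimpleGraph.CliqueFree, not_forall, not_not] at hm
    obtain ⟨s, hs⟩ := hm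
    exact hs.card_eq ▸ hs.isClique.card_le_cliqueNum
  have hmax : ¬ G.CliqueFree G.cliqueNum := by
    obtain ⟨s, hs⟩ := G.exists_isNClique_cliqueNum
    exact fun h => h s hs
  constructor
  · rintro rfl
    exact ⟨hmax, by by_contra h; have := hle _ h; omega⟩
  · rintro ⟨h₁, h₂⟩
    refine le_antisymm ?_ (hle n h₁)
    by_contra h
    exact hmax (h₂.mono (by omega))

theorem cliqueNum_joinGraph {V W : Type*} [Finite V] [Finite W] (G : SimpleGraph V)
    (H : SimpleGraph W) : (joinGraph G H).cliqueNum = G.cliqueNum + H.cliqueNum := by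
  refine le_antisymm ?_ ?_
  · obtain ⟨s, hs⟩ := (joinGraph G H).exists_isNClique_cliqueNum
    rw [← hs.card_eq, ← Finset.card_toLeft_add_card_toRight]
    exact add_le_add (isClique_toLeft hs.isClique).card_le_cliqueNum
      (isClique_toRight hs.isClique).card_le_cliqueNum
  · obtain ⟨s, hs⟩ := G.exists_isNClique_cliqueNum
    obtain ⟨t, ht⟩ := H.exists_isNClique_cliqueNum
    rw [← hs.card_eq, ← ht.card_eq, ← Finset.card_disjSum]
    exact (isClique_disjSum hs.isClique ht.isClique).card_le_cliqueNum

theorem cliqueNum_top_fin (n : ℕ) : (⊤ : SimpleGraph (Fin n)).cliqueNum = n := by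
  refine cliqueNum_eq_iff.2 ⟨fun h => ?_, SimpleGraph.cliqueFree_of_card_lt (by simp)⟩
  exact h Finset.univ ⟨fun _ _ _ _ h => h, by simp⟩

theorem cliqueNum_congr {V W : Type*} [Finite V] [Finite W] {G : SimpleGraph V}
    {H : SimpleGraph W} (e : G ≃g H) : G.cliqueNum = H.cliqueNum := by
  obtain ⟨h₁, h₂⟩ := cliqueNum_eq_iff.1 (rfl : H.cliqueNum = _)
  exact cliqueNum_eq_iff.2
    ⟨fun h => h₁ (h.comap ⟨e.symm.toEmbedding.toCopy⟩), h₂.comap ⟨e.toEmbedding.toCopy⟩⟩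

/-- Joining a reduct with a complete graph makes the clique numbers agree. -/
theorem IsReduct.exists_fin {V W : Type*} [Finite V] [Finite W] {G : SimpleGraph V}
    {H : SimpleGraph W} (h : IsReduct G H) (hH : NoIndepTriple H) :
    ∃ (n : ℕ) (K : SimpleGraph (Fin n)), NoIndepTriple K ∧ K.cliqueNum = G.cliqueNum ∧
      G.chromaticNumber ≤ K.chromaticNumber := by
  have hle : H.cliqueNum ≤ G.cliqueNum := by
    by_contra hlt
    refine (cliqueNum_eq_iff.1 (rfl : H.cliqueNum = _)).1 ?_
    refine (h.cliqueFree _ (cliqueNum_eq_iff.1 (rfl : G.cliqueNum = _)).2).mono (by omega)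
  let K := joinGraph H (⊤ : SimpleGraph (Fin (G.cliqueNum - H.cliqueNum)))
  have := Fintype.ofFinite W
  let e := K.overFinIso rfl
  refine ⟨_, K.overFin rfl, ?_, ?_, ?_⟩
  · exact (hH.join fun a b _ hab _ _ nab _ _ => nab hab).of_embedding e.symm.toEmbedding
  · rw [← cliqueNum_congr e, cliqueNum_joinGraph, cliqueNum_top_fin]
    omega
  · refine SimpleGraph.chromaticNumber_le_of_forall_imp fun k hk => h.colorable k ?_
    exact hk.of_hom (e.toHom.comp (⟨.inl, fun h => joinGraph_adj_inl_inl.2 h⟩ : H →g K))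

/-- For every positive integer `ω`, the supremum of `χ(G)` over all finite
`(P₅, banner)`-free graphs `G` with `ω(G) = ω` equals the supremum of `χ(H)` over
all finite `3K₁`-free graphs `H` with `ω(H) = ω`. -/
theorem stmt0 (ω : ℕ) (hω : 0 < ω) :
    (⨆ (n : ℕ) (G : SimpleGraph (Fin n)) (_ : IndFree (pathGraph 5) G)
        (_ : IndFree banner G) (_ : G.cliqueNum = ω), G.chromaticNumber) =
    (⨆ (n : ℕ) (H : SimpleGraph (Fin n)) (_ : IndFree threeK1 H)
        (_ : H.cliqueNum = ω), H.chromaticNumber) := by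
  refine le_antisymm ?_ ?_
  · refine iSup_le fun n => iSup_le fun G => iSup_le fun hP => iSup_le fun hB =>
      iSup_le fun hG => ?_
    obtain ⟨W, _, H, hH, hr⟩ := exists_isReduct G (.of_indFree hP) (.of_indFree hB)
    obtain ⟨m, K, hK, hKG, hχ⟩ := hr.exists_fin hH
    exact hχ.trans <| le_iSup_of_le m <| le_iSup_of_le K <|
      le_iSup_of_le (indFree_threeK1_iff.2 hK) <| le_iSup_of_le (hKG.trans hG) le_rfl
  · refine iSup_le fun n => iSup_le fun H => iSup_le fun h3 => iSup_le fun hH => ?_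
    exact le_iSup_of_le n <| le_iSup_of_le H <|
      le_iSup_of_le (h3.of_embedding threeK1EmbeddingPathGraph) <|
      le_iSup_of_le (h3.of_embedding threeK1EmbeddingBanner) <| le_iSup_of_le hH le_rfl
end

section
/- For every positive integer ω, the supremum of the chromatic number χ(G) over all finite (P5, co-banner)-free graphs G with clique number ω(G) = ω equals the supremum of χ(H) over all finite 2K2-free graphs H with ω(H) = ω. -/
open SimpleGraph

theorem indFree_iff_not_isIndContained {α β : Type*} {H : SimpleGraph α} {G : SimpleGraph β} :
    IndFree H G ↔ ¬ H.IsIndContained G := by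
  constructor
  · rintro h ⟨f⟩
    refine h (Set.range f) ⟨⟨Equiv.ofInjective f f.injective, ?_⟩⟩
    intro a b
    simp
  · rintro h s ⟨f⟩
    exact h ⟨(SimpleGraph.Embedding.induce s).comp f.toEmbedding⟩

theorem twoK2_isIndContained_pathGraph_five : twoK2.IsIndContained (pathGraph 5) := by
  refine ⟨⟨⟨![0, 1, 3, 4], by decide⟩, ?_⟩⟩
  intro a b
  fin_cases a <;> fin_cases b <;> simp [twoK2, pathGraph_adj]

theorem twoK2_isIndContained_coBanner : twoK2.IsIndContained coBanner := by
  refine ⟨⟨⟨![0, 2, 1, 3], by decide⟩, ?_⟩⟩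
  intro a b
  fin_cases a <;> fin_cases b <;> simp [twoK2, coBanner, banner]

theorem isIndContained_of_forall_lt {V : Type*} {n : ℕ} {H : SimpleGraph (Fin n)}
    {G : SimpleGraph V} (f : Fin n → V)
    (h : ∀ i j, i < j → f i ≠ f j ∧ (G.Adj (f i) (f j) ↔ H.Adj i j)) : H.IsIndContained G := by
  refine ⟨⟨⟨f, fun i j hij => ?_⟩, fun {i j} => ?_⟩⟩
  · rcases lt_trichotomy i j with hlt | rfl | hlt
    · exact absurd hij (h i j hlt).1
    · rfl
    · exact absurd hij.symm (h j i hlt).1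
  · change G.Adj (f i) (f j) ↔ H.Adj i j
    rcases lt_trichotomy i j with hlt | rfl | hlt
    · exact (h i j hlt).2
    · simp
    · rw [G.adj_comm, H.adj_comm]
      exact (h j i hlt).2

/-- The edges `vw` and `cd` induce a `2K₂` in `G`. -/
structure InducesTwoK2 {V : Type*} (G : SimpleGraph V) (v w c d : V) : Prop where
  adj_left : G.Adj v w
  adj_right : G.Adj c d
  not_adj_vc : ¬ G.Adj v c
  not_adj_vd : ¬ G.Adj v d
  not_adj_wc : ¬ G.Adj w c
  not_adj_wd : ¬ G.Adj w d

namespace InducesTwoK2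

variable {V : Type*} {G : SimpleGraph V} {v w c d x : V}

theorem swap (h : InducesTwoK2 G v w c d) : InducesTwoK2 G c d v w :=
  ⟨h.2, h.1, fun e => h.3 e.symm, fun e => h.5 e.symm, fun e => h.4 e.symm, fun e => h.6 e.symm⟩

theorem flip (h : InducesTwoK2 G v w c d) : InducesTwoK2 G w v c d :=
  ⟨h.1.symm, h.2, h.5, h.6, h.3, h.4⟩

/-- In a `(P₅, co-banner)`-free graph, a vertex with a neighbour in each edge of an induced
`2K₂` is adjacent to all four of its vertices. -/
theorem adj_of_adj (hP : ¬ (pathGraph 5).IsIndContained G) (hB : ¬ coBanner.IsIndContained G)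
    (h : InducesTwoK2 G v w c d) (hv : G.Adj x v) (hc : G.Adj x c) : G.Adj x w := by
  obtain ⟨h1, h2, h3, h4, h5, h6⟩ := h
  have n1 := h1.ne
  have n2 := h2.ne
  have n3 := hv.ne
  have n4 := hc.ne
  have n5 : v ≠ c := by rintro rfl; exact h4 h2
  have n6 : v ≠ d := by rintro rfl; exact h3 h2.symm
  have n7 : w ≠ c := by rintro rfl; exact h6 h2
  have n8 : w ≠ d := by rintro rfl; exact h5 h2.symm
  have n9 : x ≠ w := by rintro rfl; exact h5 hc
  have n10 : x ≠ d := by rintro rfl; exact h4 hv.symm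
  by_contra hw
  by_cases hd : G.Adj x d
  · refine hB (isIndContained_of_forall_lt ![w, c, v, d, x] fun i j hij => ?_)
    fin_cases i <;> fin_cases j <;> first
      | exact absurd hij (by decide)
      | simp [coBanner, banner, *, Ne.symm, Adj.symm, mt Adj.symm]
  · refine hP (isIndContained_of_forall_lt ![w, v, x, c, d] fun i j hij => ?_)
    fin_cases i <;> fin_cases j <;> first
      | exact absurd hij (by decide)
      | simp [pathGraph_adj, *, Ne.symm, Adj.symm, mt Adj.symm]

end InducesTwoK2

/-- If every vertex outside `A` with a neighbour in `A` is complete to `B`, then a colouring of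
`G - A` using on `B` as many colours as some colouring uses on `A` yields a colouring of `G`. -/
theorem colorable_of_ncard_image_le {V : Type*} {G : SimpleGraph V} {m : ℕ} {A B : Set V}
    (hAB : ∀ s ∉ A, ∀ a ∈ A, G.Adj s a → ∀ b ∈ B, G.Adj s b) (hdisj : Disjoint A B)
    {c₁ c₂ : V → Fin m}
    (h₁ : ∀ u v, u ∉ A → v ∉ A → G.Adj u v → c₁ u ≠ c₁ v)
    (h₂ : ∀ u ∈ A, ∀ v ∈ A, G.Adj u v → c₂ u ≠ c₂ v)
    (hle : (c₂ '' A).ncard ≤ (c₁ '' B).ncard) : G.Colorable m := by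
  classical
  obtain ⟨f, hf, hinj⟩ : ∃ f : Fin m → Fin m, Set.MapsTo f (c₂ '' A) (c₁ '' B) ∧
      Set.InjOn f (c₂ '' A) := by
    have hle' : (c₂ '' A).encard ≤ (c₁ '' B).encard := by
      rw [← (Set.toFinite _).cast_ncard_eq, ← (Set.toFinite (c₁ '' B)).cast_ncard_eq]
      exact_mod_cast hle
    obtain h | h := isEmpty_or_nonempty (Fin m)
    · exact ⟨id, fun x => h.elim x, Function.injective_id.injOn⟩
    obtain ⟨f, hf, hinj⟩ := (Set.toFinite (c₂ '' A)).exists_injOn_of_encard_le hle'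
    exact ⟨f, fun x hx => hf hx, hinj⟩
  have key : ∀ u ∈ A, ∀ v ∉ A, G.Adj v u → f (c₂ u) ≠ c₁ v := by
    intro u hu v hv huv e
    obtain ⟨b, hb, hb'⟩ := hf ⟨u, hu, rfl⟩
    exact h₁ v b hv (fun h => hdisj.le_bot ⟨h, hb⟩) (hAB v hv u hu huv b hb) (by rw [hb', e])
  refine ⟨Coloring.mk (fun v => if v ∈ A then f (c₂ v) else c₁ v) ?_⟩
  intro u v huv
  by_cases hu : u ∈ A <;> by_cases hv : v ∈ A <;> simp only [hu, hv, if_true, if_false]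
  · exact fun e => h₂ u hu v hv huv (hinj ⟨u, hu, rfl⟩ ⟨v, hv, rfl⟩ e)
  · exact key u hu v hv huv.symm
  · exact (key v hv u hu huv).symm
  · exact h₁ u v hu hv huv

/-- A colouring of an induced subgraph on `Aᶜ`, extended arbitrarily. -/
theorem exists_coloring_off_of_induce {V : Type*} {G : SimpleGraph V} {m : ℕ} {A B : Set V}
    (hB : B.Nonempty) (hAB : Disjoint A B) (h : (G.induce Aᶜ).Colorable m) :
    ∃ c : V → Fin m, ∀ u v, u ∉ A → v ∉ A → G.Adj u v → c u ≠ c v := by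
  classical
  obtain ⟨c⟩ := h
  obtain ⟨b, hb⟩ := hB
  have hb' : b ∈ Aᶜ := fun h => hAB.le_bot ⟨h, hb⟩
  refine ⟨fun v => if hv : v ∈ Aᶜ then c ⟨v, hv⟩ else c ⟨b, hb'⟩, fun u v hu hv huv => ?_⟩
  have hu' : u ∈ Aᶜ := hu
  have hv' : v ∈ Aᶜ := hv
  simp only [hu', hv', dif_pos]
  exact c.valid (by simpa using huv)

/-- An induced `2K₂` in a `(P₅, co-banner)`-free graph extends to a pair of disjoint sets, each
of whose outside neighbours are complete to the other set. -/
theorem exists_twin_sets {V : Type*} {G : SimpleGraph V} {a b c d : V}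
    (hP : ¬ (pathGraph 5).IsIndContained G) (hB : ¬ coBanner.IsIndContained G)
    (h : InducesTwoK2 G a b c d) :
    ∃ A B : Set V, A.Nonempty ∧ B.Nonempty ∧ Disjoint A B ∧
      (∀ s ∉ A, ∀ x ∈ A, G.Adj s x → ∀ y ∈ B, G.Adj s y) ∧
      (∀ s ∉ B, ∀ y ∈ B, G.Adj s y → ∀ x ∈ A, G.Adj s x) := by
  set B : Set V :=
    {y | Relation.ReflTransGen (fun x y => G.Adj x y ∧ ¬ G.Adj y a ∧ ¬ G.Adj y b) c y} with hBdef
  set S : Set V := {s | s ∉ B ∧ ∃ y ∈ B, G.Adj s y} with hSdef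
  set A : Set V := {y | Relation.ReflTransGen (fun x y => G.Adj x y ∧ y ∉ S) a y} with hAdef
  have hcB : c ∈ B := Relation.ReflTransGen.refl
  have haA : a ∈ A := Relation.ReflTransGen.refl
  have hBn : ∀ y ∈ B, ¬ G.Adj y a ∧ ¬ G.Adj y b := by
    intro y hy
    rcases Relation.ReflTransGen.cases_tail hy with rfl | ⟨z, -, hz⟩
    · exact ⟨fun e => h.3 e.symm, fun e => h.5 e.symm⟩
    · exact hz.2
  have hBstep : ∀ x ∈ B, ∀ y, G.Adj x y → ¬ G.Adj y a → ¬ G.Adj y b → y ∈ B :=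
    fun x hx y hxy h1 h2 => Relation.ReflTransGen.tail hx ⟨hxy, h1, h2⟩
  have haB : a ∉ B := fun e => (hBn a e).2 h.1
  have hdB : d ∈ B := hBstep c hcB d h.2 (fun e => h.4 e.symm) (fun e => h.6 e.symm)
  have hBnbr : ∀ y ∈ B, ∃ y' ∈ B, G.Adj y y' := by
    intro y hy
    rcases Relation.ReflTransGen.cases_tail hy with rfl | ⟨z, hz, hzy⟩
    · exact ⟨d, hdB, h.2⟩
    · exact ⟨z, hz, hzy.1.symm⟩
  have hAprop : ∀ x ∈ A, x ∉ B ∧ x ∉ S := by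
    intro x hx
    induction hx with
    | refl => exact ⟨haB, fun ⟨_, y, hy, hay⟩ => (hBn y hy).1 hay.symm⟩
    | @tail x y _ hxy ih => exact ⟨fun hy => ih.2 ⟨ih.1, y, hy, hxy.1⟩, hxy.2⟩
  have hAstep : ∀ x ∈ A, ∀ y, G.Adj x y → y ∉ S → y ∈ A :=
    fun x hx y hxy hy => Relation.ReflTransGen.tail hx ⟨hxy, hy⟩
  have hnAB : ∀ x ∈ A, ∀ y ∈ B, ¬ G.Adj x y :=
    fun x hx y hy hxy => (hAprop x hx).2 ⟨(hAprop x hx).1, y, hy, hxy⟩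
  have hab : ∀ y ∈ B, ∀ y' ∈ B, G.Adj y y' → InducesTwoK2 G a b y y' := fun y hy y' hy' hyy' =>
    ⟨h.1, hyy', fun e => (hBn y hy).1 e.symm, fun e => (hBn y' hy').1 e.symm,
      fun e => (hBn y hy).2 e.symm, fun e => (hBn y' hy').2 e.symm⟩
  have hSa : ∀ s ∈ S, G.Adj s a := by
    rintro s ⟨hsB, y, hy, hsy⟩
    by_contra hsa
    have hsb : G.Adj s b := by
      by_contra hsb
      exact hsB (hBstep y hy s hsy.symm hsa hsb)
    obtain ⟨y', hy', hyy'⟩ := hBnbr y hy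
    exact hsa ((hab y hy y' hy' hyy').flip.adj_of_adj hP hB hsb hsy)
  have hSA : ∀ s ∈ S, ∀ x ∈ A, G.Adj s x := by
    rintro s hs x hx
    obtain ⟨hsB, y, hy, hsy⟩ := id hs
    obtain ⟨y', hy', hyy'⟩ := hBnbr y hy
    induction hx with
    | refl => exact hSa s hs
    | @tail x z hx hxz ih =>
      have hz : z ∈ A := hAstep x hx z hxz.1 hxz.2
      exact InducesTwoK2.adj_of_adj hP hB ⟨hxz.1, hyy', hnAB x hx y hy, hnAB x hx y' hy',
        hnAB z hz y hy, hnAB z hz y' hy'⟩ ih hsy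
  have hSB : ∀ s ∈ S, ∀ y ∈ B, G.Adj s y := by
    rintro s hs
    have hiff : ∀ y ∈ B, (G.Adj s c ↔ G.Adj s y) := by
      intro y hy
      induction hy with
      | refl => rfl
      | @tail x z hx hxz ih =>
        have hk := (hab x hx z (hBstep x hx z hxz.1 hxz.2.1 hxz.2.2) hxz.1).swap
        exact ih.trans ⟨fun e => hk.adj_of_adj hP hB e (hSa s hs),
          fun e => hk.flip.adj_of_adj hP hB e (hSa s hs)⟩
    obtain ⟨hsB, y, hy, hsy⟩ := id hs
    exact fun z hz => (hiff z hz).1 ((hiff y hy).2 hsy)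
  refine ⟨A, B, ⟨a, haA⟩, ⟨c, hcB⟩, Set.disjoint_left.2 fun x hx => (hAprop x hx).1, ?_, ?_⟩
  · intro s hs x hx hsx
    refine hSB s ?_
    by_contra hsS
    exact hs (hAstep x hx s hsx.symm hsS)
  · exact fun s hs y hy hsy => hSA s ⟨hs, y, hy, hsy⟩

/-- A `(P₅, co-banner)`-free graph that is not `m`-colourable, but all of whose proper induced
subgraphs are, is `2K₂`-free. -/
theorem not_twoK2_isIndContained_of_critical {V : Type*} {G : SimpleGraph V} {m : ℕ}
    (hP : ¬ (pathGraph 5).IsIndContained G) (hB : ¬ coBanner.IsIndContained G)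
    (hm : ¬ G.Colorable m) (hcrit : ∀ t : Set V, t ≠ Set.univ → (G.induce t).Colorable m) :
    ¬ twoK2.IsIndContained G := by
  rintro ⟨f⟩
  have hadj : ∀ i j, G.Adj (f i) (f j) ↔ twoK2.Adj i j := fun i j => f.map_adj_iff
  have h : InducesTwoK2 G (f 0) (f 1) (f 2) (f 3) := by
    constructor <;> rw [hadj] <;> simp [twoK2]
  obtain ⟨A, B, hA, hB', hdisj, hAB, hBA⟩ := exists_twin_sets hP hB h
  obtain ⟨c₁, h₁⟩ := exists_coloring_off_of_induce hB' hdisj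
    (hcrit Aᶜ (by simpa using hA.ne_empty))
  obtain ⟨c₂, h₂⟩ := exists_coloring_off_of_induce hA hdisj.symm
    (hcrit Bᶜ (by simpa using hB'.ne_empty))
  have hAB' : ∀ x ∈ A, x ∉ B := fun _ hx => Set.disjoint_left.1 hdisj hx
  have hBA' : ∀ x ∈ B, x ∉ A := fun _ hx => Set.disjoint_right.1 hdisj hx
  rcases le_total (c₂ '' A).ncard (c₁ '' B).ncard with hle | hle
  · exact hm (colorable_of_ncard_image_le hAB hdisj h₁
      (fun u hu v hv => h₂ u v (hAB' u hu) (hAB' v hv)) hle)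
  · exact hm (colorable_of_ncard_image_le hBA hdisj.symm h₂
      (fun u hu v hv => h₁ u v (hBA' u hu) (hBA' v hv)) hle)

theorem exists_twoK2_free_not_colorable (n : ℕ) {m : ℕ} : ∀ {V : Type} [Finite V],
    Nat.card V = n → ∀ {G : SimpleGraph V}, ¬ (pathGraph 5).IsIndContained G →
    ¬ coBanner.IsIndContained G → ¬ G.Colorable m →
    ∃ s : Set V, ¬ twoK2.IsIndContained (G.induce s) ∧ ¬ (G.induce s).Colorable m := by
  induction n using Nat.strong_induction_on with
  | _ n ih =>
    intro V _ hn G hP hB hm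
    by_cases hcrit : ∀ t : Set V, t ≠ Set.univ → (G.induce t).Colorable m
    · refine ⟨Set.univ, fun h => ?_, fun h => hm ?_⟩
      · exact not_twoK2_isIndContained_of_critical hP hB hm hcrit
          (h.trans ⟨SimpleGraph.Embedding.induce _⟩)
      · exact h.of_hom (SimpleGraph.induceUnivIso G).symm.toHom
    · push Not at hcrit
      obtain ⟨t, ht, htm⟩ := hcrit
      have hemb : (G.induce t).IsIndContained G := ⟨SimpleGraph.Embedding.induce t⟩
      obtain ⟨s, hs, hsm⟩ := ih (Nat.card t) (by
          rw [← hn, Nat.card_coe_set_eq]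
          exact Set.ncard_lt_card ht) rfl
        (fun h => hP (h.trans hemb)) (fun h => hB (h.trans hemb)) htm
      let e : (G.induce t).induce s ≃g G.induce (Subtype.val '' s) :=
        ⟨Equiv.Set.image _ s Subtype.val_injective, by simp⟩
      exact ⟨Subtype.val '' s, fun h => hs (h.trans ⟨e.symm.toEmbedding⟩),
        fun h => hsm (h.of_hom e.toHom)⟩

/-- The graph obtained from `G` by adding a universal vertex. -/
def coneGraph {V : Type*} (G : SimpleGraph V) : SimpleGraph (Option V) where
  Adj x y := x ≠ y ∧ ∀ u v, x = some u → y = some v → G.Adj u v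
  symm := ⟨fun _ _ h => ⟨h.1.symm, fun u v hu hv => (h.2 v u hv hu).symm⟩⟩
  loopless := ⟨fun _ h => h.1 rfl⟩

namespace coneGraph

variable {V : Type*} {G : SimpleGraph V}

@[simp]
theorem adj_some_some {u v : V} : (coneGraph G).Adj (some u) (some v) ↔ G.Adj u v := by
  simp only [coneGraph, ne_eq, Option.some.injEq]
  exact ⟨fun h => h.2 u v rfl rfl, fun h => ⟨h.ne, by rintro _ _ rfl rfl; exact h⟩⟩

@[simp]
theorem adj_none_some {v : V} : (coneGraph G).Adj none (some v) := by
  simp [coneGraph]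

/-- The inclusion of a graph in its cone. -/
def someEmbedding (G : SimpleGraph V) : G ↪g coneGraph G :=
  ⟨Function.Embedding.some, by simp⟩

theorem not_twoK2_isIndContained (h : ¬ twoK2.IsIndContained G) :
    ¬ twoK2.IsIndContained (coneGraph G) := by
  rintro ⟨f⟩
  have hadj : ∀ i j, (coneGraph G).Adj (f i) (f j) ↔ twoK2.Adj i j := fun i j => f.map_adj_iff
  have hsome : ∀ i, ∃ v, f i = some v := by
    intro i
    by_contra! hi
    have hi' : f i = none := by
      cases hfi : f i with
      | none => rfl
      | some v => exact absurd hfi (hi v)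
    have hall : ∀ j, j ≠ i → twoK2.Adj i j := by
      intro j hj
      rw [← hadj, hi']
      cases hfj : f j with
      | none => exact absurd (f.injective (hfj.trans hi'.symm)) hj
      | some v => exact adj_none_some
    revert hall
    fin_cases i <;> simp [twoK2, Fin.forall_fin_succ]
  choose g hg using hsome
  refine h ⟨⟨⟨g, fun i j hij => f.injective (by rw [hg, hg, hij])⟩, fun {i j} => ?_⟩⟩
  rw [← hadj, hg, hg]
  exact adj_some_some.symm

theorem cliqueNum_eq [Finite V] : (coneGraph G).cliqueNum = G.cliqueNum + 1 := by
  classical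
  apply le_antisymm
  · obtain ⟨s, hs⟩ := (coneGraph G).exists_isNClique_cliqueNum
    have hcl : G.IsClique (Finset.eraseNone s : Finset V) := by
      intro u hu v hv huv
      have := hs.isClique (Finset.mem_eraseNone.1 hu) (Finset.mem_eraseNone.1 hv) (by simpa using huv)
      simpa using this
    have h1 := hcl.card_le_cliqueNum
    have h2 : s.card ≤ (Finset.eraseNone s).card + 1 := by
      calc s.card ≤ (Finset.insertNone (Finset.eraseNone s)).card := by
            rw [Finset.insertNone_eraseNone]
            exact Finset.card_le_card (Finset.subset_insert _ _)
        _ = _ := Finset.card_insertNone _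
    rw [← hs.card_eq]
    omega
  · obtain ⟨s, hs⟩ := G.exists_isNClique_cliqueNum
    have hcl : (coneGraph G).IsClique (Finset.insertNone s : Finset (Option V)) := by
      intro x hx y hy hxy
      refine ⟨hxy, ?_⟩
      rintro u v rfl rfl
      exact hs.isClique (by simpa using hx) (by simpa using hy) (by simpa using hxy)
    have h1 := hcl.card_le_cliqueNum
    rwa [Finset.card_insertNone, hs.card_eq] at h1

end coneGraph

theorem exists_twoK2_free_cliqueNum_add (r : ℕ) {V : Type} [Finite V] {G : SimpleGraph V}
    (h : ¬ twoK2.IsIndContained G) :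
    ∃ (W : Type) (_ : Finite W) (H : SimpleGraph W), ¬ twoK2.IsIndContained H ∧
      H.cliqueNum = G.cliqueNum + r ∧ G.IsIndContained H := by
  induction r with
  | zero => exact ⟨V, inferInstance, G, h, rfl, .rfl⟩
  | succ r ih =>
    obtain ⟨W, _, H, hH, hcl, hGH⟩ := ih
    refine ⟨Option W, inferInstance, coneGraph H, coneGraph.not_twoK2_isIndContained hH, ?_,
      hGH.trans ⟨coneGraph.someEmbedding H⟩⟩
    rw [coneGraph.cliqueNum_eq, hcl, add_assoc]

theorem SimpleGraph.IsIndContained.cliqueNum_le {V W : Type*} [Finite W] {G : SimpleGraph V}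
    {H : SimpleGraph W} (h : G.IsIndContained H) : G.cliqueNum ≤ H.cliqueNum := by
  obtain ⟨f⟩ := h
  have : Finite V := Finite.of_injective f f.injective
  obtain ⟨s, hs⟩ := G.exists_isNClique_cliqueNum
  have hcl : H.IsClique (s.map f.toEmbedding : Finset W) := by
    intro x hx y hy hxy
    obtain ⟨u, hu, rfl⟩ := Finset.mem_map.1 hx
    obtain ⟨v, hv, rfl⟩ := Finset.mem_map.1 hy
    exact f.map_adj_iff.2 (hs.isClique hu hv fun e => hxy (by rw [e]))
  have h1 := hcl.card_le_cliqueNum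
  rwa [Finset.card_map, hs.card_eq] at h1

/-- For every positive integer `ω`, the supremum of `χ(G)` over all finite
`(P₅, co-banner)`-free graphs `G` with `ω(G) = ω` equals the supremum of `χ(H)` over
all finite `2K₂`-free graphs `H` with `ω(H) = ω`. -/
theorem stmt1 (ω : ℕ) (hω : 0 < ω) :
    (⨆ (n : ℕ) (G : SimpleGraph (Fin n)) (_ : IndFree (pathGraph 5) G)
        (_ : IndFree coBanner G) (_ : G.cliqueNum = ω), G.chromaticNumber) =
    (⨆ (n : ℕ) (H : SimpleGraph (Fin n)) (_ : IndFree twoK2 H)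
        (_ : H.cliqueNum = ω), H.chromaticNumber) := by
  apply le_antisymm
  · refine iSup_le fun n => iSup_le fun G => iSup_le fun hP => iSup_le fun hB => iSup_le fun hG => ?_
    rw [indFree_iff_not_isIndContained] at hP hB
    by_contra hlt
    rw [not_le] at hlt
    obtain ⟨m, hm⟩ := ENat.ne_top_iff_exists.1 hlt.ne_top
    rw [← hm] at hlt
    have hGm : ¬ G.Colorable m := fun h => hlt.not_ge h.chromaticNumber_le
    obtain ⟨s, hs, hsm⟩ := exists_twoK2_free_not_colorable _ rfl hP hB hGm
    have hle : (G.induce s).cliqueNum ≤ ω := hG ▸ G.cliqueNum_induce_le s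
    obtain ⟨W, _, H, hH, hcl, hemb⟩ :=
      exists_twoK2_free_cliqueNum_add (ω - (G.induce s).cliqueNum) hs
    have := Fintype.ofFinite W
    let e := H.overFinIso rfl
    have he : (H.overFin rfl).IsIndContained H := ⟨e.symm.toEmbedding⟩
    have he' : H.IsIndContained (H.overFin rfl) := ⟨e.toEmbedding⟩
    have hbound : (H.overFin rfl).chromaticNumber ≤ m := by
      rw [hm]
      refine le_iSup_of_le (Fintype.card W) <| le_iSup_of_le (H.overFin rfl) <|
        le_iSup_of_le (indFree_iff_not_isIndContained.2 fun h => hH (h.trans he)) <|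
        le_iSup_of_le ?_ le_rfl
      rw [le_antisymm he.cliqueNum_le he'.cliqueNum_le, hcl]
      omega
    obtain ⟨f⟩ := hemb.trans he'
    exact hsm ((chromaticNumber_le_iff_colorable.1 hbound).of_hom f.toHom)
  · refine iSup_le fun n => iSup_le fun H => iSup_le fun hH => iSup_le fun hcl => ?_
    rw [indFree_iff_not_isIndContained] at hH
    exact le_iSup_of_le n <| le_iSup_of_le H <|
      le_iSup_of_le (indFree_iff_not_isIndContained.2 fun h =>
        hH (twoK2_isIndContained_pathGraph_five.trans h)) <|
      le_iSup_of_le (indFree_iff_not_isIndContained.2 fun h =>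
        hH (twoK2_isIndContained_coBanner.trans h)) <|
      le_iSup_of_le hcl le_rfl
end

section
/- Every finite (P5, banner)-free graph G with at least one vertex satisfies χ(G) ≤ ⌈(Δ(G) + ω(G) + 1)/2⌉, where Δ(G) is the maximum degree of G. -/
open SimpleGraph

section

variable {V : Type}

/-- `G` is properly coloured on `s` by some map into `k` colours. -/
def ColorableOn (G : SimpleGraph V) (s : Set V) (k : ℕ) : Prop :=
  ∃ f : V → Fin k, ∀ u ∈ s, ∀ v ∈ s, G.Adj u v → f u ≠ f v

/-- `G` has no induced path on five vertices, in terms of vertices. -/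
def NoP5 (G : SimpleGraph V) : Prop :=
  ∀ a b c d e, G.Adj a b → G.Adj b c → G.Adj c d → G.Adj d e →
    ¬ G.Adj a c → ¬ G.Adj a d → ¬ G.Adj a e → ¬ G.Adj b d → ¬ G.Adj b e → ¬ G.Adj c e → False

/-- `G` has no induced banner, in terms of vertices: `abcd` is the 4-cycle, `e` the pendant
vertex attached to `a`. -/
def NoBanner (G : SimpleGraph V) : Prop :=
  ∀ a b c d e, G.Adj a b → G.Adj b c → G.Adj c d → G.Adj d a → G.Adj a e →
    ¬ G.Adj a c → b ≠ d → ¬ G.Adj b d → ¬ G.Adj b e → ¬ G.Adj c e → ¬ G.Adj d e → False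

/-- The vertices reachable from `y` by `r`-steps inside `X`. -/
def comp (r : V → V → Prop) (X : Set V) (y : V) : Set V :=
  {v | Relation.ReflTransGen (fun u v => r u v ∧ v ∈ X) y v}

section comp
variable {r : V → V → Prop} {X : Set V} {y : V}

lemma mem_comp_self : y ∈ comp r X y := Relation.ReflTransGen.refl

lemma comp_closed {u v : V} (hu : u ∈ comp r X y) (hr : r u v) (hv : v ∈ X) :
    v ∈ comp r X y := Relation.ReflTransGen.tail hu ⟨hr, hv⟩

lemma comp_subset (hy : y ∈ X) : comp r X y ⊆ X := by
  intro v hv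
  induction hv with
  | refl => exact hy
  | tail _ h _ => exact h.2

lemma comp_crossing_of_mem {v : V} (hv : v ∈ comp r X y) (U : Set V) (hyU : y ∈ U)
    (hvU : v ∉ U) : ∃ p ∈ comp r X y, ∃ q ∈ comp r X y, p ∈ U ∧ q ∉ U ∧ r p q := by
  induction hv with
  | refl => exact absurd hyU hvU
  | @tail b c hb hbc ih =>
    by_cases hbU : b ∈ U
    · exact ⟨b, hb, c, comp_closed hb hbc.1 hbc.2, hbU, hvU, hbc.1⟩
    · exact ih hbU

/-- A component is connected: `r` crosses every partition of it. -/
lemma comp_crossing (hr : ∀ u v, r u v → r v u) (U : Set V) {u v : V}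
    (hu : u ∈ comp r X y) (huU : u ∈ U) (hv : v ∈ comp r X y) (hvU : v ∉ U) :
    ∃ p ∈ comp r X y, ∃ q ∈ comp r X y, p ∈ U ∧ q ∉ U ∧ r p q := by
  by_cases hy : y ∈ U
  · exact comp_crossing_of_mem hv U hy hvU
  · obtain ⟨p, hp, q, hq, hpU, hqU, hpq⟩ := comp_crossing_of_mem hu Uᶜ hy (by simpa using huU)
    exact ⟨q, hq, p, hp, by simpa using hqU, hpU, hr _ _ hpq⟩

end comp

/-- There is no separator `S` splitting off `C` in which nonadjacent vertices have the same
neighbours outside `S`. -/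
def NoModularCut (G : SimpleGraph V) : Prop :=
  ∀ S C : Set V,
    (∀ c ∈ S, ∀ d ∈ S, c ≠ d → ¬ G.Adj c d → ∀ v ∉ S, G.Adj v c → G.Adj v d) →
    C.Nonempty → (∀ v ∈ C, v ∉ S) → (∀ u ∈ C, ∀ v, v ∉ C → v ∉ S → ¬ G.Adj u v) →
    (∃ v, v ∉ C ∧ v ∉ S) → False

/-- The complement of `G` is connected. -/
def CoConnected (G : SimpleGraph V) : Prop :=
  ∀ A : Set V, A.Nonempty → Aᶜ.Nonempty → ∃ a ∈ A, ∃ b ∉ A, ¬ G.Adj a b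

section structural
variable {G : SimpleGraph V}

/-- A module of a co-connected banner-free graph without modular cuts is a clique. -/
lemma module_isClique (hB : NoBanner G) (hcut : NoModularCut G) (hco : CoConnected G)
    {M : Set V} (hM : Mᶜ.Nonempty)
    (hmod : ∀ w ∉ M, ∀ p ∈ M, ∀ q ∈ M, G.Adj w p → G.Adj w q)
    {a b : V} (ha : a ∈ M) (hb : b ∈ M) (hab : a ≠ b) : G.Adj a b := by
  by_contra hnab
  obtain ⟨m, hm, v, hv, hmv⟩ := hco M ⟨a, ha⟩ hM
  refine hcut {v | v ∉ M ∧ G.Adj v a} M ?_ ⟨a, ha⟩ (fun v hv h => h.1 hv) ?_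
    ⟨v, hv, fun h => hmv (hmod v hv a ha m hm h.2).symm⟩
  · rintro c ⟨hc, hca⟩ d ⟨hd, hda⟩ hcd hncd w hw hwc
    by_cases hwM : w ∈ M
    · exact (hmod d hd a ha w hwM hda).symm
    · have hwa : ¬ G.Adj w a := fun h => hw ⟨hwM, h⟩
      have hwb : ¬ G.Adj w b := fun h => hwa (hmod w hwM b hb a ha h)
      by_contra hwd
      exact hB c a d b w hca hda.symm (hmod d hd a ha b hb hda) (hmod c hc a ha b hb hca).symm
        hwc.symm hncd hab hnab (fun h => hwa h.symm) (fun h => hwd h.symm) (fun h => hwb h.symm)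
  · intro u hu w hw hwS huw
    exact hwS ⟨hw, hmod w hw u hu a ha huw.symm⟩

/-- A co-connected banner-free graph without modular cuts has no induced `K₂,₃`. -/
lemma no_K23 (hB : NoBanner G) (hcut : NoModularCut G) (hco : CoConnected G)
    {a b c d e : V} (hcd : c ≠ d) (hce : c ≠ e) (hde : d ≠ e)
    (ncd : ¬ G.Adj c d) (nce : ¬ G.Adj c e) (nde : ¬ G.Adj d e)
    (hab : a ≠ b) (nab : ¬ G.Adj a b)
    (hac : G.Adj a c) (had : G.Adj a d) (hae : G.Adj a e)
    (hbc : G.Adj b c) (hbd : G.Adj b d) (hbe : G.Adj b e) : False := by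
  set X : Set V := {v | G.Adj v c ∧ G.Adj v d ∧ G.Adj v e} with hX
  set r : V → V → Prop := fun u v => u ≠ v ∧ ¬ G.Adj u v with hr
  have hrs : ∀ u v, r u v → r v u := fun u v h => ⟨h.1.symm, fun h' => h.2 h'.symm⟩
  have haX : a ∈ X := ⟨hac, had, hae⟩
  have hbX : b ∈ X := ⟨hbc, hbd, hbe⟩
  have hsub := comp_subset (r := r) haX
  have hcA : c ∉ comp r X a := fun h => G.irrefl (hsub h).1
  -- a vertex adjacent to `p'` but not to `p`, where `p` and `p'` form a 4-cycle with any two of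
  -- `c, d, e`
  have key : ∀ w p p' c d e, p ≠ p' → ¬ G.Adj p p' → G.Adj p c → G.Adj p d → G.Adj p e →
      G.Adj p' c → G.Adj p' d → G.Adj p' e → G.Adj w p' → ¬ G.Adj w p → w ≠ p →
      c ≠ d → c ≠ e → d ≠ e → ¬ G.Adj c d → ¬ G.Adj c e → ¬ G.Adj d e → G.Adj w e := by
    intro w p p' c d e hpp npp hpc hpd hpe hpc' hpd' hpe' hwp' hwp hwpne hcd hce hde ncd nce nde
    by_contra hwe
    have h1 : ∀ c, G.Adj p c → G.Adj p' c → c ≠ e → ¬ G.Adj c e → G.Adj w c := by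
      intro c hpc hpc' hce nce
      by_contra hwc
      exact hB p' c p e w hpc' hpc.symm hpe hpe'.symm hwp'.symm (fun h => npp h.symm) hce nce
        (fun h => hwc h.symm) (fun h => hwp h.symm) (fun h => hwe h.symm)
    have hwc := h1 c hpc hpc' hce nce
    have hwd := h1 d hpd hpd' hde nde
    exact hB p c w d e hpc hwc.symm hwd hpd.symm hpe (fun h => hwp h.symm) hcd ncd nce hwe nde
  refine nab (module_isClique hB hcut hco (M := comp r X a) ⟨c, hcA⟩ ?_ mem_comp_self
    (comp_closed mem_comp_self ⟨hab, nab⟩ hbX) hab)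
  intro w hw p hp q hq hwp
  by_contra hwq
  obtain ⟨p', hp', q', hq', hwp', hwq', hne, hn⟩ :=
    comp_crossing hrs {v | G.Adj w v} hp hwp hq hwq
  obtain ⟨h1, h2, h3⟩ := hsub hp'
  obtain ⟨h4, h5, h6⟩ := hsub hq'
  have hwq'' : w ≠ q' := fun h => hw (h ▸ hq')
  have hn' : ¬ G.Adj q' p' := fun h => hn h.symm
  have nsymm : ∀ u v, ¬ G.Adj u v → ¬ G.Adj v u := fun u v h h' => h h'.symm
  have hwX : w ∈ X :=
    ⟨key w q' p' d e c hne.symm hn' h5 h6 h4 h2 h3 h1 hwp' hwq' hwq'' hde hcd.symm hce.symm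
        nde (nsymm _ _ ncd) (nsymm _ _ nce),
      key w q' p' c e d hne.symm hn' h4 h6 h5 h1 h3 h2 hwp' hwq' hwq'' hce hcd hde.symm
        nce ncd (nsymm _ _ nde),
      key w q' p' c d e hne.symm hn' h4 h5 h6 h1 h2 h3 hwp' hwq' hwq'' hcd hce hde ncd nce nde⟩
  exact hw (comp_closed hq' ⟨hwq''.symm, nsymm _ _ hwq'⟩ hwX)

/-- In a co-connected `(P₅, banner)`-free graph without modular cuts every induced 4-cycle is
dominating. -/
lemma four_cycle_dominating (hP : NoP5 G) (hB : NoBanner G) (hcut : NoModularCut G)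
    (hco : CoConnected G) {a b c d z : V} (hab : G.Adj a b) (hbc : G.Adj b c) (hcd : G.Adj c d)
    (hda : G.Adj d a) (hac : a ≠ c) (nac : ¬ G.Adj a c) (hbd : b ≠ d) (nbd : ¬ G.Adj b d)
    (hza : ¬ G.Adj z a) (hzb : ¬ G.Adj z b) (hzc : ¬ G.Adj z c) (hzd : ¬ G.Adj z d)
    (hz : z ≠ a) : False := by
  have nsymm : ∀ u v, ¬ G.Adj u v → ¬ G.Adj v u := fun u v h h' => h h'.symm
  set Z : Set V := {v | v ≠ a ∧ ¬ G.Adj v a ∧ ¬ G.Adj v b ∧ ¬ G.Adj v c ∧ ¬ G.Adj v d} with hZ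
  have hzZ : z ∈ Z := ⟨hz, hza, hzb, hzc, hzd⟩
  have hsub := comp_subset (r := G.Adj) hzZ
  -- a vertex with a neighbour in `Z` that sees one vertex of the cycle sees the next one
  have step : ∀ x k a b c d, G.Adj a b → G.Adj b c → G.Adj c d → G.Adj d a → a ≠ c →
      ¬ G.Adj a c → b ≠ d → ¬ G.Adj b d → G.Adj x k → ¬ G.Adj k a → ¬ G.Adj k b →
      ¬ G.Adj k c → ¬ G.Adj k d → G.Adj x a → G.Adj x b := by
    intro x k a b c d hab hbc hcd hda hac nac hbd nbd hxk hka hkb hkc hkd hxa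
    by_contra hxb
    by_cases hxc : G.Adj x c
    · exact hB x a b c k hxa hab hbc hxc.symm hxk hxb hac nac (nsymm _ _ hka) (nsymm _ _ hkb)
        (nsymm _ _ hkc)
    · by_cases hxd : G.Adj x d
      · exact hP k x a b c hxk.symm hxa hab hbc hka hkb hkc hxb hxc nac
      · exact hB a b c d x hab hbc hcd hda hxa.symm nac hbd nbd (nsymm _ _ hxb) (nsymm _ _ hxc)
          (nsymm _ _ hxd)
  have full : ∀ x k, G.Adj x k → k ∈ Z → x ∉ Z → G.Adj x a ∧ G.Adj x c := by
    rintro x k hxk ⟨hka, nka, nkb, nkc, nkd⟩ hx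
    have s1 := step x k a b c d hab hbc hcd hda hac nac hbd nbd hxk nka nkb nkc nkd
    have s2 := step x k b c d a hbc hcd hda hab hbd nbd hac.symm (nsymm _ _ nac) hxk nkb nkc nkd
      nka
    have s3 := step x k c d a b hcd hda hab hbc hac.symm (nsymm _ _ nac) hbd.symm
      (nsymm _ _ nbd) hxk nkc nkd nka nkb
    have s4 := step x k d a b c hda hab hbc hcd hbd.symm (nsymm _ _ nbd) hac nac hxk nkd nka nkb
      nkc
    have hxa : x ≠ a := by rintro rfl; exact nka hxk.symm
    have : G.Adj x a ∨ G.Adj x b ∨ G.Adj x c ∨ G.Adj x d := by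
      by_contra hcon
      push Not at hcon
      exact hx ⟨hxa, hcon⟩
    tauto
  refine hcut {x | x ∉ Z ∧ ∃ k ∈ comp G.Adj Z z, G.Adj x k} (comp G.Adj Z z) ?_
    ⟨z, mem_comp_self⟩ (fun v hv h => h.1 (hsub hv)) ?_ ⟨a, fun h => (hsub h).1 rfl, ?_⟩
  · rintro x ⟨hx, k, hk, hxk⟩ y ⟨hy, l, hl, hyl⟩ hxy nxy
    exfalso
    obtain ⟨hxa, hxc⟩ := full x k hxk (hsub hk) hx
    obtain ⟨hya, hyc⟩ := full y l hyl (hsub hl) hy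
    obtain ⟨hka, nka, nkb, nkc, nkd⟩ := hsub hk
    have hkc : k ≠ c := by rintro rfl; exact nkb hbc.symm
    have hyk : G.Adj y k := by
      by_contra nyk
      exact hB x a y c k hxa hya.symm hyc hxc.symm hxk nxy hac nac (nsymm _ _ nka) nyk
        (nsymm _ _ nkc)
    exact no_K23 hB hcut hco hac hka.symm hkc.symm nac (nsymm _ _ nka) (nsymm _ _ nkc)
      hxy nxy hxa hxc hxk hya hyc hyk
  · intro u hu v hv hvS huv
    by_cases hvZ : v ∈ Z
    · exact hv (comp_closed hu huv hvZ)
    · exact hvS ⟨hvZ, u, hu, huv.symm⟩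
  · rintro ⟨-, k, hk, hak⟩
    exact (hsub hk).2.1 hak.symm

/-- Two vertices of an independent triple have only pairwise adjacent common neighbours. -/
lemma adj_of_common (hP : NoP5 G) (hB : NoBanner G) (hcut : NoModularCut G)
    (hco : CoConnected G) {u v w s t : V} (huv : u ≠ v) (huw : u ≠ w) (hvw : v ≠ w)
    (nuv : ¬ G.Adj u v) (nuw : ¬ G.Adj u w) (nvw : ¬ G.Adj v w)
    (hsu : G.Adj s u) (hsv : G.Adj s v) (htu : G.Adj t u) (htv : G.Adj t v) (hst : s ≠ t) :
    G.Adj s t := by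
  have nsymm : ∀ u v, ¬ G.Adj u v → ¬ G.Adj v u := fun u v h h' => h h'.symm
  by_contra nst
  by_cases hsw : G.Adj s w
  · by_cases htw : G.Adj t w
    · exact no_K23 hB hcut hco huv huw hvw nuv nuw nvw hst nst hsu hsv hsw htu htv htw
    · exact hB s u t v w hsu htu.symm htv hsv.symm hsw nst huv nuv nuw htw nvw
  · by_cases htw : G.Adj t w
    · exact hB t u s v w htu hsu.symm hsv htv.symm htw (nsymm _ _ nst) huv nuv nuw hsw nvw
    · exact four_cycle_dominating hP hB hcut hco hsu.symm hsv htv.symm htu huv nuv hst nst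
        (nsymm _ _ nuw) (nsymm _ _ hsw) (nsymm _ _ nvw) (nsymm _ _ htw) huw.symm

/-- If `r` sees the end `a` of an induced path `abc` and a vertex `z` anticomplete to the path,
then `r` sees `b`. -/
lemma adj_of_path_of_pendant (hP : NoP5 G) (hB : NoBanner G) {a b c r z : V}
    (hab : G.Adj a b) (hbc : G.Adj b c) (hac : a ≠ c) (nac : ¬ G.Adj a c) (hrz : G.Adj r z)
    (nza : ¬ G.Adj z a) (nzb : ¬ G.Adj z b) (nzc : ¬ G.Adj z c) (hra : G.Adj r a) :
    G.Adj r b := by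
  have nsymm : ∀ u v, ¬ G.Adj u v → ¬ G.Adj v u := fun u v h h' => h h'.symm
  by_contra hrb
  by_cases hrc : G.Adj r c
  · exact hB r a b c z hra hab hbc hrc.symm hrz hrb hac nac
      (nsymm _ _ nza) (nsymm _ _ nzb) (nsymm _ _ nzc)
  · exact hP z r a b c hrz.symm hra hab hbc nza nzb nzc hrb hrc nac

lemma adj_or_adj_of_not_adj (hP : NoP5 G) {X : Set V} {y x s t : V}
    (hx : ∀ p ∈ comp G.Adj X y, ¬ G.Adj x p)
    (hxs : G.Adj x s) (hxt : G.Adj x t) (nst : ¬ G.Adj s t)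
    (hcommon : ∀ p ∈ comp G.Adj X y, G.Adj s p → ¬ G.Adj t p)
    {c : V} (hc : c ∈ comp G.Adj X y) (hsc : G.Adj s c) {p : V} (hp : p ∈ comp G.Adj X y) :
    G.Adj s p ∨ G.Adj t p := by
  have nsymm : ∀ u v, ¬ G.Adj u v → ¬ G.Adj v u := fun u v h h' => h h'.symm
  by_contra hn
  obtain ⟨u, hu, w, hw, huU, hwU, huw⟩ := comp_crossing (r := G.Adj) (fun _ _ h => h.symm)
    {v | G.Adj s v ∨ G.Adj t v} hc (Or.inl hsc) hp hn
  have hwU' : ¬ G.Adj s w ∧ ¬ G.Adj t w := not_or.mp hwU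
  rcases huU with hsu | htu
  · exact hP t x s u w hxt.symm hxs hsu huw (nsymm _ _ nst) (hcommon u hu hsu) hwU'.2
      (hx u hu) (hx w hw) hwU'.1
  · exact hP s x t u w hxs.symm hxt htu huw nst (fun h => hcommon u hu h htu) hwU'.1
      (hx u hu) (hx w hw) hwU'.2

/-- In a co-connected `(P₅, banner)`-free graph without modular cuts the independence
number is at most two. -/
theorem no_independent_triple (hP : NoP5 G) (hB : NoBanner G) (hcut : NoModularCut G)
    (hco : CoConnected G) {x y z : V} (hxy : x ≠ y) (hxz : x ≠ z) (hyz : y ≠ z)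
    (nxy : ¬ G.Adj x y) (nxz : ¬ G.Adj x z) (nyz : ¬ G.Adj y z) : False := by
  have nsymm : ∀ u v, ¬ G.Adj u v → ¬ G.Adj v u := fun u v h h' => h h'.symm
  set A : Set V := {v | v ≠ x ∧ ¬ G.Adj x v} with hA
  set X : Set V := {v | v ∈ A ∧ ∃ q ∈ A, q ≠ v ∧ ¬ G.Adj v q} with hX
  have hyX : y ∈ X := ⟨⟨hxy.symm, nxy⟩, z, ⟨hxz.symm, nxz⟩, hyz.symm, nyz⟩
  have hzX : z ∈ X := ⟨⟨hxz.symm, nxz⟩, y, ⟨hxy.symm, nxy⟩, hyz, nsymm _ _ nyz⟩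
  have huniv : ∀ d ∈ A, d ∉ X → ∀ v ∈ A, v ≠ d → G.Adj d v := by
    intro d hd hdX v hv hvd
    by_contra h
    exact hdX ⟨hd, v, hv, hvd, h⟩
  have hclq : ∀ p ∈ X, ∀ s t, G.Adj x s → G.Adj x t → G.Adj s p → G.Adj t p → s ≠ t →
      G.Adj s t := by
    rintro p ⟨hp, q, hq, hqp, npq⟩ s t hxs hxt hsp htp hst
    exact adj_of_common hP hB hcut hco hp.1.symm hq.1.symm hqp.symm hp.2 hq.2 npq
      hxs.symm hsp hxt.symm htp hst
  -- the neighbourhood of a component of `X` contains two nonadjacent vertices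
  have hsep : ∀ y ∈ X, ∃ s t, s ≠ t ∧ ¬ G.Adj s t ∧
      (s ∉ comp G.Adj X y ∧ ∃ c ∈ comp G.Adj X y, G.Adj s c) ∧
      (t ∉ comp G.Adj X y ∧ ∃ c ∈ comp G.Adj X y, G.Adj t c) := by
    intro y hy
    have hsub := comp_subset (r := G.Adj) hy
    by_contra! hcon
    refine hcut {s | s ∉ comp G.Adj X y ∧ ∃ c ∈ comp G.Adj X y, G.Adj s c} (comp G.Adj X y)
      ?_ ⟨y, mem_comp_self⟩ (fun v hv h => h.1 hv) ?_ ⟨x, fun h => (hsub h).1.1 rfl, ?_⟩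
    · rintro s hs t ⟨ht, c, hc, htc⟩ hst nst
      exact absurd htc (hcon s t hst nst hs ht c hc)
    · intro u hu v hv hvS huv
      exact hvS ⟨hv, u, hu, huv.symm⟩
    · rintro ⟨-, c, hc, hxc⟩
      exact (hsub hc).1.2 hxc
  -- vertices of the neighbourhood are neighbours of `x`, or universal in `A`
  have hnbr : ∀ y ∈ X, ∀ s, s ∉ comp G.Adj X y → (∃ c ∈ comp G.Adj X y, G.Adj s c) →
      G.Adj x s ∨ (s ∈ A ∧ s ∉ X) := by
    rintro y hy s hs ⟨c, hc, hsc⟩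
    by_cases hxs : G.Adj x s
    · exact Or.inl hxs
    · refine Or.inr ⟨⟨?_, hxs⟩, fun hsX => hs (comp_closed hc hsc.symm hsX)⟩
      rintro rfl
      exact (comp_subset hy hc).1.2 hsc
  have hmix : ∀ p ∈ X, ∀ s d, G.Adj x s → G.Adj s p → d ∈ A → d ∉ X → G.Adj s d := by
    rintro p hpX s d hxs hsp hd hdX
    obtain ⟨hp, q, hq, hqp, npq⟩ := id hpX
    have hpd : p ≠ d := by rintro rfl; exact hdX hpX
    have hdp := huniv d hd hdX p hp hpd
    have hqd : q ≠ d := by rintro rfl; exact npq hdp.symm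
    have hdq := huniv d hd hdX q hq hqd
    by_contra nsd
    by_cases hsq : G.Adj s q
    · exact nsd (adj_of_common hP hB hcut hco hqp.symm hp.1 hq.1 npq (nsymm _ _ hp.2)
        (nsymm _ _ hq.2) hsp hsq hdp hdq (by rintro rfl; exact hd.2 hxs))
    · exact hP x s p d q hxs hsp hdp.symm hdq hp.2 hd.2 hq.2 nsd hsq npq
  have hsep' : ∀ y ∈ X, ∃ s t, s ≠ t ∧ ¬ G.Adj s t ∧ G.Adj x s ∧ G.Adj x t ∧
      (∃ c ∈ comp G.Adj X y, G.Adj s c) ∧ (∃ c ∈ comp G.Adj X y, G.Adj t c) := by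
    intro y hy
    have hsub := comp_subset (r := G.Adj) hy
    obtain ⟨s, t, hst, nst, ⟨hs, hsc⟩, ht, htc⟩ := hsep y hy
    obtain ⟨c, hc, hsc'⟩ := id hsc
    obtain ⟨c', hc', htc'⟩ := id htc
    rcases hnbr y hy s hs hsc with hxs | hsA <;> rcases hnbr y hy t ht htc with hxt | htA
    · exact ⟨s, t, hst, nst, hxs, hxt, hsc, htc⟩
    · exact absurd (hmix c (hsub hc) s t hxs hsc' htA.1 htA.2) nst
    · exact absurd (hmix c' (hsub hc') t s hxt htc' hsA.1 hsA.2).symm nst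
    · exact absurd (huniv s hsA.1 hsA.2 t htA.1 hst.symm) nst
  -- a 5-cycle `x s c c' t`
  obtain ⟨s, t, hst, nst, hxs, hxt, ⟨c₀, hc₀, hsc₀⟩, c₁, hc₁, htc₁⟩ := hsep' y hyX
  have hsub := comp_subset (r := G.Adj) hyX
  have hcom : ∀ p ∈ comp G.Adj X y, G.Adj s p → ¬ G.Adj t p := fun p hp hsp htp =>
    nst (hclq p (hsub hp) s t hxs hxt hsp htp hst)
  obtain ⟨c, hc, c', hc', hsc, nsc', hcc'⟩ := comp_crossing (r := G.Adj) (fun _ _ h => h.symm)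
    {v | G.Adj s v} hc₀ hsc₀ hc₁ (fun h => hcom c₁ hc₁ h htc₁)
  have hx : ∀ p ∈ comp G.Adj X y, ¬ G.Adj x p := fun p hp => (hsub hp).1.2
  have hdich : ∀ p ∈ comp G.Adj X y, G.Adj s p ∨ G.Adj t p := fun p hp =>
    adj_or_adj_of_not_adj hP hx hxs hxt nst hcom hc hsc hp
  have htc' : G.Adj t c' := (hdich c' hc').resolve_left nsc'
  have ntc := hcom c hc hsc
  have nts := nsymm _ _ nst
  -- the component of `y` is a clique
  have hcomm : ∀ s t, G.Adj x s → G.Adj x t → ¬ G.Adj s t →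
      ∀ p c c', ¬ G.Adj x p → ¬ G.Adj x c → ¬ G.Adj x c' → G.Adj s p → ¬ G.Adj t p →
      G.Adj s c → ¬ G.Adj t c → G.Adj t c' → ¬ G.Adj s c' → G.Adj c c' → G.Adj p c' := by
    intro s t hxs hxt nst p c c' nxp nxc nxc' hsp ntp hsc ntc htc' nsc' hcc'
    by_contra npc'
    by_cases hpc : G.Adj p c
    · exact hP p c c' t x hpc hcc' htc'.symm hxt.symm npc' (nsymm _ _ ntp) (nsymm _ _ nxp)
        (nsymm _ _ ntc) (nsymm _ _ nxc) (nsymm _ _ nxc')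
    · exact hP p s c c' t hsp.symm hsc hcc' htc'.symm hpc npc' (nsymm _ _ ntp) nsc' nst
        (nsymm _ _ ntc)
  have hs_c' : ∀ p ∈ comp G.Adj X y, G.Adj s p → G.Adj p c' := fun p hp hsp =>
    hcomm s t hxs hxt nst p c c' (hx p hp) (hx c hc) (hx c' hc') hsp (hcom p hp hsp) hsc ntc
      htc' nsc' hcc'
  have ht_c : ∀ q ∈ comp G.Adj X y, G.Adj t q → ∀ p ∈ comp G.Adj X y, G.Adj s p →
      G.Adj q p := fun q hq htq p hp hsp =>
    hcomm t s hxt hxs nts q c' p (hx q hq) (hx c' hc') (hx p hp) htq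
      (fun h => hcom q hq h htq) htc' nsc' hsp (hcom p hp hsp) (hs_c' p hp hsp).symm
  have hclique : ∀ p ∈ comp G.Adj X y, ∀ q ∈ comp G.Adj X y, p ≠ q → G.Adj p q := by
    intro p hp q hq hpq
    by_contra npq
    rcases hdich p hp with hsp | htp <;> rcases hdich q hq with hsq | htq
    · exact hB c' p s q t (hs_c' p hp hsp).symm hsp.symm hsq (hs_c' q hq hsq) htc'.symm
        (nsymm _ _ nsc') hpq npq (nsymm _ _ (hcom p hp hsp)) nst (nsymm _ _ (hcom q hq hsq))
    · exact npq (ht_c q hq htq p hp hsp).symm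
    · exact npq (ht_c p hp htp q hq hsq)
    · exact hB c p t q s (ht_c p hp htp c hc hsc).symm htp.symm htq (ht_c q hq htq c hc hsc)
        hsc.symm (nsymm _ _ ntc) hpq npq (fun h => hcom p hp h.symm htp) nts
        (fun h => hcom q hq h.symm htq)
  have hzC : z ∉ comp G.Adj X y := fun h => nyz (hclique y mem_comp_self z h hyz)
  have hsubz := comp_subset (r := G.Adj) hzX
  -- the component of `z` is anticomplete to the 5-cycle
  have hdisj : ∀ w ∈ comp G.Adj X z, w ∉ comp G.Adj X y := by
    intro w hw hwy
    obtain ⟨p, hp, q, hq, hpU, hqU, hpq⟩ := comp_crossing (r := G.Adj) (fun _ _ h => h.symm)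
      (comp G.Adj X y) hw hwy mem_comp_self hzC
    exact hqU (comp_closed hpU hpq (hsubz hq))
  have hanti : ∀ w ∈ comp G.Adj X z, ¬ G.Adj w x ∧ ¬ G.Adj w s ∧ ¬ G.Adj w c ∧
      ¬ G.Adj w c' ∧ ¬ G.Adj w t := by
    intro w hw
    have nwx : ¬ G.Adj w x := nsymm _ _ (hsubz hw).1.2
    have hwc : ∀ c ∈ comp G.Adj X y, ¬ G.Adj w c := fun c hc h =>
      hdisj w hw (comp_closed hc h.symm (hsubz hw))
    have nwc := hwc c hc
    have nwc' := hwc c' hc'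
    have nws : ¬ G.Adj w s := by
      intro hws
      by_cases hwt : G.Adj w t
      · exact hB s w t x c hws.symm hwt hxt.symm hxs hsc nst (hsubz hw).1.1 nwx nwc ntc
          (hx c hc)
      · exact hP w s c c' t hws hsc hcc' htc'.symm nwc nwc' hwt nsc' nst (nsymm _ _ ntc)
    have nwt : ¬ G.Adj w t := fun hwt =>
      hP w t c' c s hwt htc' hcc'.symm hsc.symm nwc' nwc nws ntc nts (nsymm _ _ nsc')
    exact ⟨nwx, nws, nwc, nwc', nwt⟩
  obtain ⟨r, r', hrr', nrr', hxr, hxr', ⟨w, hw, hrw⟩, w', hw', hrw'⟩ := hsep' z hzX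
  have hrc : ∀ r, G.Adj x r → (∃ w ∈ comp G.Adj X z, G.Adj r w) → G.Adj r c := by
    rintro r hxr ⟨w, hw, hrw⟩
    obtain ⟨h1, h2, h3, h4, -⟩ := hanti w hw
    have hrs := adj_of_path_of_pendant hP hB hxs hsc (hsub hc).1.1.symm (hx c hc) hrw h1 h2 h3
      hxr.symm
    exact adj_of_path_of_pendant hP hB hsc hcc' (by rintro rfl; exact nst htc'.symm) nsc' hrw
      h2 h3 h4 hrs
  exact nrr' (hclq c (hsub hc) r r' hxr hxr' (hrc r hxr ⟨w, hw, hrw⟩) (hrc r' hxr' ⟨w', hw', hrw'⟩)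
    hrr')

end structural

section merging
variable {G : SimpleGraph V} {k : ℕ}

lemma comp_eq_of_mem {r : V → V → Prop} (hr : ∀ u v, r u v → r v u) {X : Set V} {u v : V}
    (hv : v ∈ X) (hu : u ∈ comp r X v) : comp r X u = comp r X v := by
  have hback : v ∈ comp r X u := by
    by_contra h
    obtain ⟨p, -, q, hq, hpU, hqU, hpq⟩ :=
      comp_crossing hr (comp r X u) hu mem_comp_self mem_comp_self h
    exact hqU (comp_closed hpU hpq (comp_subset hv hq))
  exact Set.Subset.antisymm (fun w hw => Relation.ReflTransGen.trans hu hw)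
    (fun w hw => Relation.ReflTransGen.trans hback hw)

/-- Two colourings of `B` can be replaced by colourings using some of the same colours
that have the same colour classes. -/
lemma exists_recolor (f g : V → Fin k) (B : Set V) :
    ∃ f' g' : V → Fin k, (∀ v ∈ B, f' v ∈ f '' B) ∧ (∀ v ∈ B, g' v ∈ g '' B) ∧
      (∀ u ∈ B, ∀ v ∈ B, f' u = f' v ↔ g' u = g' v) ∧
      ∀ u ∈ B, ∀ v ∈ B, f u ≠ f v → g u ≠ g v → f' u ≠ f' v := by
  classical
  have key : ∀ f g : V → Fin k, (f '' B).toFinset.card ≤ (g '' B).toFinset.card →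
      ∃ h : Fin k → Fin k, (∀ v ∈ B, h (f v) ∈ g '' B) ∧ Set.InjOn h (f '' B) := by
    intro f g hle
    obtain ⟨e⟩ : Nonempty ((f '' B : Set (Fin k)) ↪ (g '' B : Set (Fin k))) :=
      Function.Embedding.nonempty_of_card_le (by simpa [Set.toFinset_card] using hle)
    refine ⟨fun c => if hc : c ∈ f '' B then e ⟨c, hc⟩ else c, ?_, ?_⟩
    · intro v hv
      have : f v ∈ f '' B := ⟨v, hv, rfl⟩
      simp only [this, dif_pos]
      exact (e _).2
    · intro c hc d hd hcd
      simp only [hc, hd, dif_pos] at hcd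
      exact congrArg Subtype.val (e.injective (Subtype.ext hcd))
  have hmem : ∀ f : V → Fin k, ∀ v ∈ B, f v ∈ f '' B := fun f v hv => ⟨v, hv, rfl⟩
  rcases le_total (f '' B).toFinset.card (g '' B).toFinset.card with hle | hle
  · obtain ⟨h, hm, hi⟩ := key f g hle
    exact ⟨f, fun v => h (f v), hmem f, hm,
      fun u hu v hv => (hi.eq_iff (hmem f u hu) (hmem f v hv)).symm, fun _ _ _ _ h _ => h⟩
  · obtain ⟨h, hm, hi⟩ := key g f hle
    exact ⟨fun v => h (g v), g, hm, hmem g,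
      fun u hu v hv => hi.eq_iff (hmem g u hu) (hmem g v hv),
      fun u hu v hv _ hg => fun he => hg ((hi.eq_iff (hmem g u hu) (hmem g v hv)).mp he)⟩

/-- Two maps with the same fibres on `S` differ by a permutation of the colours. -/
lemma exists_perm_of_same_fibres (f g : V → Fin k) (S : Set V)
    (h : ∀ u ∈ S, ∀ v ∈ S, f u = f v ↔ g u = g v) :
    ∃ π : Fin k → Fin k, Function.Injective π ∧ ∀ v ∈ S, π (g v) = f v := by
  classical
  let φ : Fin k → Fin k := fun c => if hc : ∃ v ∈ S, g v = c then f hc.choose else c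
  have hφ : ∀ v ∈ S, φ (g v) = f v := by
    intro v hv
    have hc : ∃ w ∈ S, g w = g v := ⟨v, hv, rfl⟩
    simp only [φ, hc, dif_pos]
    exact (h _ hc.choose_spec.1 v hv).mpr hc.choose_spec.2
  obtain ⟨e, he⟩ := Set.MapsTo.exists_equiv_extend_of_card_eq (t := Finset.univ) (s := g '' S)
    (f := φ) (by simp) (fun _ _ => by simp) (by
      rintro _ ⟨u, hu, rfl⟩ _ ⟨v, hv, rfl⟩ huv
      rw [hφ u hu, hφ v hv] at huv
      exact (h u hu v hv).mp huv)
  exact ⟨fun c => e c, fun c d hcd => e.injective (Subtype.ext hcd),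
    fun v hv => (he _ ⟨v, hv, rfl⟩).trans (hφ v hv)⟩

/-- Colourings of the two sides of a modular cut can be merged. -/
theorem colorable_of_modular_cut {S C : Set V}
    (hS : ∀ c ∈ S, ∀ d ∈ S, c ≠ d → ¬ G.Adj c d → ∀ v ∉ S, G.Adj v c → G.Adj v d)
    (hCS : ∀ v ∈ C, v ∉ S) (hC : ∀ u ∈ C, ∀ v, v ∉ C → v ∉ S → ¬ G.Adj u v)
    (h₁ : ColorableOn G (C ∪ S) k) (h₂ : ColorableOn G Cᶜ k) : G.Colorable k := by
  classical
  obtain ⟨f, hf⟩ := h₁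
  obtain ⟨g, hg⟩ := h₂
  set r : V → V → Prop := fun u v => u ≠ v ∧ ¬ G.Adj u v with hr
  have hrs : ∀ u v, r u v → r v u := fun u v h => ⟨h.1.symm, fun h' => h.2 h'.symm⟩
  set K : V → Set V := fun v => comp r S v with hK
  have hKS : ∀ v ∈ S, K v ⊆ S := fun v hv => comp_subset hv
  have hself : ∀ v, v ∈ K v := fun v => mem_comp_self
  have hKadj : ∀ u ∈ S, ∀ v ∈ S, K u ≠ K v → G.Adj u v := by
    intro u hu v hv huv
    by_contra hn
    have hne : u ≠ v := by rintro rfl; exact huv rfl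
    exact huv (comp_eq_of_mem hrs hu (comp_closed mem_comp_self ⟨hne, hn⟩ hv)).symm
  have hKout : ∀ w ∉ S, ∀ v ∈ S, ∀ u ∈ K v, G.Adj w v → G.Adj w u := by
    intro w hw v hv u hu hwv
    by_contra hn
    obtain ⟨p, hp, q, hq, hpU, hqU, hpq⟩ :=
      comp_crossing hrs {v | G.Adj w v} mem_comp_self hwv hu hn
    exact hqU (hS p (hKS v hv hp) q (hKS v hv hq) hpq.1 hpq.2 w hw hpU)
  choose F F' hF hF' hFF hFne using fun B : Set V => exists_recolor f g B
  set f' : V → Fin k := fun v => if v ∈ S then F (K v) v else f v with hf'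
  set g' : V → Fin k := fun v => if v ∈ S then F' (K v) v else g v with hg'
  have ker : ∀ u ∈ S, ∀ v ∈ S, K u = K v → (f' u = f' v ↔ g' u = g' v) := by
    intro u hu v hv huv
    simp only [hf', hg', hu, hv, if_true]
    rw [huv]
    exact hFF _ u (huv ▸ hself u) v (hself v)
  have proper_same : ∀ u ∈ S, ∀ v ∈ S, K u = K v → G.Adj u v → f' u ≠ f' v := by
    intro u hu v hv huv hadj
    simp only [hf', hu, hv, if_true]
    rw [huv]
    exact hFne _ u (huv ▸ hself u) v (hself v) (hf u (Or.inr hu) v (Or.inr hv) hadj)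
      (hg u (fun h => hCS u h hu) v (fun h => hCS v h hv) hadj)
  have proper : ∀ (f f' : V → Fin k) (T : Set V), S ⊆ T →
      (∀ u ∈ T, ∀ v ∈ T, G.Adj u v → f u ≠ f v) → (∀ v ∉ S, f' v = f v) →
      (∀ v ∈ S, f' v ∈ f '' K v) →
      (∀ u ∈ S, ∀ v ∈ S, K u = K v → G.Adj u v → f' u ≠ f' v) →
      (∀ u ∈ S, ∀ v ∈ S, K u ≠ K v → f' u ≠ f' v) ∧
      ∀ u ∈ T, ∀ v ∈ T, G.Adj u v → f' u ≠ f' v := by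
    intro f f' T hST hf hout hin hsame
    have hdiff : ∀ u ∈ S, ∀ v ∈ S, K u ≠ K v → f' u ≠ f' v := by
      intro u hu v hv huv
      obtain ⟨u₀, hu₀, eu⟩ := hin u hu
      obtain ⟨v₀, hv₀, ev⟩ := hin v hv
      rw [← eu, ← ev]
      have hu' := comp_eq_of_mem hrs hu hu₀
      have hv' := comp_eq_of_mem hrs hv hv₀
      refine hf u₀ (hST (hKS u hu hu₀)) v₀ (hST (hKS v hv hv₀))
        (hKadj u₀ (hKS u hu hu₀) v₀ (hKS v hv hv₀) ?_)
      exact fun h => huv (hu'.symm.trans (h.trans hv'))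
    have hmix : ∀ u ∈ S, ∀ v ∈ T, v ∉ S → G.Adj u v → f' u ≠ f' v := by
      intro u hu v hvT hv hadj
      obtain ⟨u₀, hu₀, eu⟩ := hin u hu
      rw [← eu, hout v hv]
      exact hf u₀ (hST (hKS u hu hu₀)) v hvT (hKout v hv u hu u₀ hu₀ hadj.symm).symm
    refine ⟨hdiff, fun u hu v hv hadj => ?_⟩
    by_cases huS : u ∈ S <;> by_cases hvS : v ∈ S
    · by_cases huv : K u = K v
      · exact hsame u huS v hvS huv hadj
      · exact hdiff u huS v hvS huv
    · exact hmix u huS v hv hvS hadj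
    · exact (hmix v hvS u hu huS hadj.symm).symm
    · rw [hout u huS, hout v hvS]
      exact hf u hu v hv hadj
  obtain ⟨hfd, hfp⟩ := proper f f' (C ∪ S) Set.subset_union_right hf
    (fun v hv => by simp [hf', hv])
    (fun v hv => by simpa [hf', hv] using hF (K v) v (hself v)) proper_same
  obtain ⟨hgd, hgp⟩ := proper g g' Cᶜ (fun v hv h => hCS v h hv) hg
    (fun v hv => by simp [hg', hv])
    (fun v hv => by simpa [hg', hv] using hF' (K v) v (hself v))
    (fun u hu v hv huv hadj h => proper_same u hu v hv huv hadj ((ker u hu v hv huv).mpr h))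
  obtain ⟨π, hπ, hπS⟩ := exists_perm_of_same_fibres f' g' S (by
    intro u hu v hv
    by_cases huv : K u = K v
    · exact ker u hu v hv huv
    · exact iff_of_false (hfd u hu v hv huv) (hgd u hu v hv huv))
  refine ⟨Coloring.mk (fun v => if v ∈ C then f' v else π (g' v)) ?_⟩
  have cross : ∀ u ∈ C, ∀ v ∉ C, G.Adj u v → f' u ≠ π (g' v) := by
    intro u hu v hv hadj
    have hvS : v ∈ S := by
      by_contra h
      exact hC u hu v hv h hadj
    rw [hπS v hvS]
    exact hfp u (Or.inl hu) v (Or.inr hvS) hadj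
  intro u v hadj
  by_cases hu : u ∈ C <;> by_cases hv : v ∈ C <;> simp only [hu, hv, if_true, if_false]
  · exact hfp u (Or.inl hu) v (Or.inl hv) hadj
  · exact cross u hu v hv hadj
  · exact (cross v hv u hu hadj.symm).symm
  · exact fun h => hgp u hu v hv hadj (hπ h)

end merging

section matchings
variable {G : SimpleGraph V}

lemma sym2_class {σ : V → V} {u v : V} (h : s(u, σ u) = s(v, σ v)) : v = u ∨ v = σ u := by
  have hv : v ∈ s(u, σ u) := h ▸ Sym2.mem_mk_left v (σ v)
  simpa using hv

lemma sym2_involutive {σ : V → V} (hσ : Function.Involutive σ) (v : V) :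
    s(σ v, σ (σ v)) = s(v, σ v) := by
  rw [hσ v, Sym2.eq_swap]

/-- An involution encoding a matching in the complement of `G`; its fixed points are the
unmatched vertices. -/
def IsCoMatching (G : SimpleGraph V) (σ : V → V) : Prop :=
  Function.Involutive σ ∧ ∀ v, ¬ G.Adj v (σ v)

open Classical in
/-- Rematch the unmatched vertex `x` with `y`, leaving the former partner of `y` unmatched. -/
noncomputable def rematch (σ : V → V) (x y : V) : V → V :=
  fun v => if v = x then y else if v = y then x else if v = σ y then v else σ v

lemma IsCoMatching.rematch {σ : V → V} (hσ : IsCoMatching G σ) {x y : V} (hx : σ x = x)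
    (hxy : x ≠ y) (nxy : ¬ G.Adj x y) : IsCoMatching G (rematch σ x y) := by
  have hi := hσ.1
  refine ⟨fun v => ?_, fun v => ?_⟩
  · have hv := hi v
    have hy := hi y
    unfold _root_.rematch
    by_cases h1 : v = x
    · simp [h1, hxy.symm]
    by_cases h2 : v = y
    · simp [h2]
    by_cases h3 : v = σ y
    · rw [if_neg h1, if_neg h2, if_pos h3, if_neg h1, if_neg h2, if_pos h3]
    have h4 : σ v ≠ x := fun h => h1 (by rw [← hv, h, hx])
    have h5 : σ v ≠ y := fun h => h3 (by rw [← hv, h])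
    have h6 : σ v ≠ σ y := fun h => h2 (hi.injective h)
    simp [h1, h2, h3, h4, h5, h6, hv]
  · unfold _root_.rematch
    split_ifs with h1 h2 h3
    · rwa [h1]
    · rw [h2]
      exact fun h => nxy h.symm
    · exact G.irrefl
    · exact hσ.2 v

variable [Fintype V]

open Classical in
/-- The number of fixed points of `σ`. -/
noncomputable def fixCard (σ : V → V) : ℕ := (Finset.univ.filter fun v => σ v = v).card

open Classical in
lemma card_add_fixCard {ι : Type*} (g : V → ι) {σ : V → V} (hσ : Function.Involutive σ)
    (hg : ∀ v, g (σ v) = g v) (hinj : ∀ u v, g u = g v → v = u ∨ v = σ u) :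
    Fintype.card V + fixCard σ = 2 * (Finset.univ.image g).card := by
  have h₁ : Fintype.card V =
      ∑ c ∈ Finset.univ.image g, (Finset.univ.filter fun v => g v = c).card :=
    Finset.card_eq_sum_card_image g Finset.univ
  have h₂ : fixCard σ = ∑ c ∈ Finset.univ.image g,
      ((Finset.univ.filter fun v => σ v = v).filter fun v => g v = c).card :=
    Finset.card_eq_sum_card_fiberwise (fun v _ => by simp)
  rw [h₁, h₂, ← Finset.sum_add_distrib, mul_comm, ← smul_eq_mul, ← Finset.sum_const]
  refine Finset.sum_congr rfl fun c hc => ?_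
  obtain ⟨u, -, rfl⟩ := Finset.mem_image.mp hc
  have e₁ : (Finset.univ.filter fun v => g v = g u) = {u, σ u} := by
    ext v
    simp only [Finset.mem_filter, Finset.mem_univ, true_and, Finset.mem_insert,
      Finset.mem_singleton]
    exact ⟨fun h => hinj u v h.symm, by rintro (rfl | rfl); exacts [rfl, hg u]⟩
  rw [Finset.filter_comm, e₁]
  by_cases hu : σ u = u
  · simp [hu, Finset.filter_singleton]
  · have hu' : u ≠ σ u := fun h => hu h.symm
    rw [Finset.card_pair hu', Finset.filter_eq_empty_iff.mpr]
    · simp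
    · intro v hv
      rcases Finset.mem_insert.mp hv with rfl | hv
      · exact hu
      · rw [Finset.mem_singleton.mp hv, hσ u]
        exact hu'

lemma even_card_add_fixCard {σ : V → V} (hσ : Function.Involutive σ) :
    Even (Fintype.card V + fixCard σ) := by
  classical
  rw [card_add_fixCard (fun v => s(v, σ v)) hσ (sym2_involutive hσ) fun _ _ => sym2_class]
  exact even_two_mul _

lemma colorable_of_coMatching {σ : V → V} (hσ : IsCoMatching G σ) {k : ℕ}
    (hk : Fintype.card V + fixCard σ ≤ 2 * k) : G.Colorable k := by
  classical
  rw [card_add_fixCard (fun v => s(v, σ v)) hσ.1 (sym2_involutive hσ.1)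
    fun _ _ => sym2_class] at hk
  have C : G.Coloring (Finset.univ.image fun v => s(v, σ v)) :=
    Coloring.mk (fun v => ⟨s(v, σ v), Finset.mem_image_of_mem _ (Finset.mem_univ v)⟩) (by
      intro u v huv h
      rcases sym2_class (congrArg Subtype.val h) with rfl | rfl
      · exact G.irrefl huv
      · exact hσ.2 u huv)
  have hcard := C.colorable
  rw [Fintype.card_coe] at hcard
  refine hcard.mono (le_trans (le_of_eq ?_) (Nat.le_of_mul_le_mul_left hk two_pos))
  congr
  exact Subsingleton.elim _ _

/-- With independence number at most two, a colouring of `G - x` gives a matching of the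
complement missing `x`. -/
lemma exists_coMatching_of_colorableOn
    (hα : ∀ x y z, x ≠ y → x ≠ z → y ≠ z → ¬ G.Adj x y → ¬ G.Adj x z → ¬ G.Adj y z → False)
    {k : ℕ} {x : V} (hx : ColorableOn G {x}ᶜ k) :
    ∃ σ, IsCoMatching G σ ∧ σ x = x ∧ Fintype.card V + fixCard σ ≤ 2 * (k + 1) := by
  classical
  obtain ⟨f, hf⟩ := hx
  set g : V → Option (Fin k) := fun v => if v = x then none else some (f v) with hg
  have hgadj : ∀ u v, g u = g v → ¬ G.Adj u v := by
    intro u v huv hadj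
    by_cases hu : u = x <;> by_cases hv : v = x <;> simp [hg, hu, hv] at huv
    · subst hu hv
      exact G.irrefl hadj
    · exact hf u hu v hv hadj huv
  have hthree : ∀ u v w, g u = g v → g u = g w → u ≠ v → u ≠ w → v = w := by
    intro u v w huv huw hv hw
    by_contra hvw
    exact hα u v w hv hw hvw (hgadj u v huv) (hgadj u w huw) (hgadj v w (huv.symm.trans huw))
  set σ : V → V := fun u => if h : ∃ w, w ≠ u ∧ g u = g w then h.choose else u with hσ
  have hσg : ∀ u, g (σ u) = g u := by
    intro u
    by_cases h : ∃ w, w ≠ u ∧ g u = g w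
    · simp only [hσ, h, dif_pos]
      exact h.choose_spec.2.symm
    · simp [hσ, h]
  have hσ' : ∀ u w, w ≠ u → g u = g w → σ u = w := by
    intro u w hw huw
    have h : ∃ w, w ≠ u ∧ g u = g w := ⟨w, hw, huw⟩
    simp only [hσ, h, dif_pos]
    exact hthree u _ w h.choose_spec.2 huw h.choose_spec.1.symm hw.symm
  have hinv : Function.Involutive σ := by
    intro u
    by_cases hu : σ u = u
    · rw [hu, hu]
    · exact hσ' (σ u) u (fun h => hu h.symm) (hσg u)
  refine ⟨σ, ⟨hinv, fun v => hgadj _ _ (hσg v).symm⟩, ?_, ?_⟩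
  · have := hσg x
    by_contra hne
    simp [hg, hne] at this
  · rw [card_add_fixCard g hinv hσg]
    · refine Nat.mul_le_mul_left 2 ((Finset.card_le_univ _).trans ?_)
      simp
    · intro u v huv
      by_cases h : v = u
      · exact Or.inl h
      · exact Or.inr (hσ' u v h huv).symm

lemma fixCard_rematch_lt {σ : V → V} {x y : V} (hx : σ x = x) (hy : σ y = y)
    (hxy : x ≠ y) : fixCard (rematch σ x y) < fixCard σ := by
  classical
  refine Finset.card_lt_card (Finset.ssubset_iff_of_subset ?_ |>.mpr ⟨x, by simpa, ?_⟩)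
  · intro v
    simp only [Finset.mem_filter, Finset.mem_univ, true_and]
    unfold rematch
    split_ifs with h1 h2 h3
    · exact fun h => absurd (h1 ▸ h.symm) hxy
    · exact fun h => absurd (h2 ▸ h) hxy
    · intro _
      rw [h3, hy, hy]
    · exact id
  · rw [Finset.mem_filter]
    simp [rematch, hxy.symm]

lemma fixCard_rematch_eq {σ : V → V} (hσ : Function.Involutive σ) {x y : V} (hx : σ x = x)
    (hy : σ y ≠ y) : fixCard (rematch σ x y) = fixCard σ := by
  classical
  have hxy : x ≠ y := by rintro rfl; exact hy hx
  have hσyx : σ y ≠ x := fun h => hxy (by rw [← hσ y, h, hx])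
  have hset : (Finset.univ.filter fun v => rematch σ x y v = v) =
      insert (σ y) ((Finset.univ.filter fun v => σ v = v).erase x) := by
    ext v
    simp only [Finset.mem_filter, Finset.mem_univ, true_and, Finset.mem_insert,
      Finset.mem_erase]
    unfold rematch
    split_ifs with h1 h2 h3
    · subst h1
      simp [hxy.symm, hσyx.symm]
    · subst h2
      simp [hxy, hy, Ne.symm hy]
    · simp [h3]
    · simp [h1, h3]
  unfold fixCard
  rw [hset, Finset.card_insert_of_notMem, Finset.card_erase_add_one]
  · simpa
  · simpa [hσ y, hσyx] using Ne.symm hy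

/-- The transitivity step in the Gallai lemma: if `σ` is a maximum matching missing `u` and `v`, and
`t` is missed by some maximum matching, then a maximum matching misses `t` and one of
`u`, `v`. -/
lemma exists_coMatching_missing_pair {m : ℕ} (hmin : ∀ σ, IsCoMatching G σ → m ≤ fixCard σ)
    {u v t : V} (huv : u ≠ v) {σ : V → V} (hσ : IsCoMatching G σ) (hσm : fixCard σ = m)
    (hu : σ u = u) (hv : σ v = v) (ht : ∃ τ, IsCoMatching G τ ∧ τ t = t ∧ fixCard τ = m) :
    ∃ τ, IsCoMatching G τ ∧ fixCard τ = m ∧ τ t = t ∧ (τ u = u ∨ τ v = v) := by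
  classical
  by_contra! hcon
  set P : Finset (V → V) :=
    Finset.univ.filter fun τ => IsCoMatching G τ ∧ τ t = t ∧ fixCard τ = m with hP
  obtain ⟨τ₀, hτ₀⟩ := ht
  obtain ⟨τ, hτP, hmax⟩ := P.exists_max_image
    (fun τ => (Finset.univ.filter fun v => σ v = τ v).card) ⟨τ₀, by simpa [hP] using hτ₀⟩
  obtain ⟨hτ, hτt, hτm⟩ : IsCoMatching G τ ∧ τ t = t ∧ fixCard τ = m := by
    simpa [hP] using hτP
  obtain ⟨hτu, hτv⟩ := hcon τ hτ hτm hτt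
  obtain ⟨x, hxt, hτx, hσx⟩ : ∃ x, x ≠ t ∧ τ x = x ∧ σ x ≠ x := by
    by_contra! hall
    have hsub : (Finset.univ.filter fun v => τ v = v) ⊆
        insert t (((Finset.univ.filter fun v => σ v = v).erase u).erase v) := by
      intro w hw
      simp only [Finset.mem_filter, Finset.mem_univ, true_and] at hw
      simp only [Finset.mem_insert, Finset.mem_erase, Finset.mem_filter, Finset.mem_univ,
        true_and]
      by_cases hwt : w = t
      · exact Or.inl hwt
      · exact Or.inr ⟨by rintro rfl; exact hτv hw, by rintro rfl; exact hτu hw, hall w hwt hw⟩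
    have h1 := (Finset.card_le_card hsub).trans (Finset.card_insert_le _ _)
    have h2 : v ∈ (Finset.univ.filter fun v => σ v = v).erase u := by
      simp [huv.symm, hv]
    have h3 : u ∈ Finset.univ.filter fun v => σ v = v := by simp [hu]
    have h4 := Finset.card_erase_add_one h2
    have h5 := Finset.card_erase_add_one h3
    unfold fixCard at hτm hσm
    omega
  have hxy : x ≠ σ x := fun h => hσx h.symm
  have nxy := hσ.2 x
  have hτ' := hτ.rematch hτx hxy nxy
  by_cases hy : τ (σ x) = σ x
  · have := fixCard_rematch_lt hτx hy hxy
    have := hmin _ hτ'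
    omega
  · have hτ't : rematch τ x (σ x) t = t := by
      have h1 : t ≠ σ x := by rintro h; rw [← h] at hy; exact hy hτt
      have h2 : t ≠ τ (σ x) := fun h => h1 (by rw [← hτ.1 (σ x), ← h, hτt])
      simp [rematch, hxt.symm, h1, hτt]
    have hle := hmax (rematch τ x (σ x))
      (by simpa [hP] using ⟨hτ', hτ't, (fixCard_rematch_eq hτ.1 hτx hy).trans hτm⟩)
    refine absurd hle (not_le.mpr (Finset.card_lt_card
      (Finset.ssubset_iff_of_subset ?_ |>.mpr ⟨x, ?_, ?_⟩)))
    · intro w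
      simp only [Finset.mem_filter, Finset.mem_univ, true_and]
      unfold rematch
      split_ifs with h1 h2 h3
      · exact fun _ => by rw [h1]
      · exact fun _ => by rw [h2, hσ.1 x]
      · intro h
        have : w = x := by
          have h7 : τ w = σ x := by rw [h3, hτ.1]
          exact hσ.1.injective (h.trans h7)
        exact absurd this h1
      · exact id
    · rw [Finset.mem_filter]
      simp [rematch]
    · simpa [hτx] using hσx

/-- The Gallai lemma: if the complement of `G` is connected and each vertex is missed by a maximum
matching of the complement, then maximum matchings miss at most one vertex. -/
theorem gallai_lemma [Nonempty V] (hco : CoConnected G) {m : ℕ}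
    (hmin : ∀ σ, IsCoMatching G σ → m ≤ fixCard σ)
    (hmiss : ∀ v, ∃ σ, IsCoMatching G σ ∧ σ v = v ∧ fixCard σ = m) : m ≤ 1 := by
  classical
  by_contra! hm
  obtain ⟨x⟩ := ‹Nonempty V›
  obtain ⟨σ, hσ, hσx, hσm⟩ := hmiss x
  set A : Set V := {v | v = x ∨ ∀ τ, IsCoMatching G τ → fixCard τ = m → τ x = x → τ v ≠ v}
    with hA
  obtain ⟨y, hy, hyx⟩ := Finset.exists_mem_ne (s := Finset.univ.filter fun v => σ v = v)
    (by unfold fixCard at hσm; omega) x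
  have hσy : σ y = y := by simpa using hy
  have hyA : y ∉ A := by
    rintro (h | h)
    · exact hyx h
    · exact h σ hσ hσm hσx hσy
  obtain ⟨a, ha, b, hb, nab⟩ := hco A ⟨x, Or.inl rfl⟩ ⟨y, hyA⟩
  have hab : a ≠ b := by rintro rfl; exact hb ha
  have hpair : ∀ τ, IsCoMatching G τ → fixCard τ = m → τ a = a → τ b ≠ b := by
    intro τ hτ hτm hτa hτb
    have := fixCard_rematch_lt hτa hτb hab
    have := hmin _ (hτ.rematch hτa hab nab)
    omega
  simp only [hA, Set.mem_ofPred_eq, not_or, not_forall, not_not] at hb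
  obtain ⟨hbx, τ, hτ, hτm, hτx, hτb⟩ := hb
  rcases ha with rfl | ha
  · exact hpair τ hτ hτm hτx hτb
  · obtain ⟨ρ, hρ, hρm, hρa, h | h⟩ :=
      exists_coMatching_missing_pair hmin hbx hτ hτm hτb hτx (hmiss a)
    · exact hpair ρ hρ hρm hρa h
    · exact ha ρ hρ hρm h hρa

end matchings

section main

lemma ColorableOn.mono {G : SimpleGraph V} {s : Set V} {k l : ℕ} (h : ColorableOn G s k)
    (hkl : k ≤ l) : ColorableOn G s l := by
  obtain ⟨f, hf⟩ := h
  exact ⟨fun v => Fin.castLE hkl (f v), fun u hu v hv huv h =>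
    hf u hu v hv huv (Fin.castLE_injective hkl h)⟩

lemma colorable_join {G : SimpleGraph V} {s : Set V} {k l : ℕ} (hs : ColorableOn G s k)
    (hs' : ColorableOn G sᶜ l) : G.Colorable (k + l) := by
  classical
  obtain ⟨f, hf⟩ := hs
  obtain ⟨g, hg⟩ := hs'
  have C : G.Coloring (Fin k ⊕ Fin l) :=
    Coloring.mk (fun v => if v ∈ s then Sum.inl (f v) else Sum.inr (g v)) (by
      intro u v huv h
      by_cases hu : u ∈ s <;> by_cases hv : v ∈ s <;> simp [hu, hv] at h
      · exact hf u hu v hv huv h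
      · exact hg u hu v hv huv h)
  simpa using C.colorable

lemma IndFree.noP5 {G : SimpleGraph V} (h : IndFree (pathGraph 5) G) : NoP5 G := by
  intro a b c d e hab hbc hcd hde nac nad nae nbd nbe nce
  have hinj : Function.Injective ![a, b, c, d, e] := by
    intro i j hij
    fin_cases i <;> fin_cases j <;> simp at hij ⊢ <;> subst hij <;>
      simp_all [G.adj_comm]
  let φ : pathGraph 5 ↪g G := ⟨⟨_, hinj⟩, by
    intro i j
    fin_cases i <;> fin_cases j <;> simp_all [pathGraph_adj, G.adj_comm]⟩
  exact h _ ⟨φ.isoInduceRange⟩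

lemma IndFree.noBanner {G : SimpleGraph V} (h : IndFree banner G) : NoBanner G := by
  intro a b c d e hab hbc hcd hda hae nac hbd nbd nbe nce nde
  have hinj : Function.Injective ![a, b, c, d, e] := by
    intro i j hij
    fin_cases i <;> fin_cases j <;> simp at hij ⊢ <;> subst hij <;>
      simp_all [G.adj_comm]
  let φ : banner ↪g G := ⟨⟨_, hinj⟩, by
    intro i j
    fin_cases i <;> fin_cases j <;> simp_all [banner, G.adj_comm]⟩
  exact h _ ⟨φ.isoInduceRange⟩

/-- `G` restricted to `s` satisfies the colouring bound, with the maximum degree replaced by the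
degree of some vertex of `s` and the clique number by the size of some clique in `s`. -/
def HasColorBound (G : SimpleGraph V) (s : Set V) : Prop :=
  ∃ v ∈ s, ∃ K : Finset V, (∀ w ∈ K, w ∈ s) ∧ G.IsClique (K : Set V) ∧
    ColorableOn G s (((s ∩ G.neighborSet v).ncard + K.card + 2) / 2)

lemma hasColorBound_of_induce [Fintype V] {G : SimpleGraph V} {s : Set V} [Fintype s]
    [DecidableRel (G.induce s).Adj] (hs : s.Nonempty)
    (h : (G.induce s).Colorable (((G.induce s).maxDegree + (G.induce s).cliqueNum + 2) / 2)) :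
    HasColorBound G s := by
  have : Nonempty s := hs.to_subtype
  obtain ⟨v, hv⟩ := (G.induce s).exists_maximal_degree_vertex
  obtain ⟨K, hK⟩ := (G.induce s).exists_isNClique_cliqueNum
  have hdeg : (s ∩ G.neighborSet v).ncard = (G.induce s).degree v := by
    rw [← card_neighborFinset_eq_degree, ← Finset.card_map (Function.Embedding.subtype _),
      ← Set.ncard_coe_finset]
    congr 1
    ext w
    simp [and_comm]
  refine ⟨v, v.2, K.map (Function.Embedding.subtype _), ?_, ?_, ?_⟩
  · intro w hw
    obtain ⟨w, -, rfl⟩ := Finset.mem_map.mp hw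
    exact w.2
  · intro u hu w hw huw
    obtain ⟨u, hu', rfl⟩ := Finset.mem_map.mp (Finset.mem_coe.mp hu)
    obtain ⟨w, hw', rfl⟩ := Finset.mem_map.mp (Finset.mem_coe.mp hw)
    exact hK.1 hu' hw' fun h => huw (congrArg _ h)
  · rw [Finset.card_map, hK.2]
    classical
    obtain ⟨C⟩ := h
    rw [hv, ← hdeg] at C
    refine ⟨fun w => if hw : w ∈ s then C ⟨w, hw⟩ else C v, fun u hu w hw huw => ?_⟩
    simp only [hu, hw, dif_pos]
    exact C.valid huw

section
variable [Fintype V] {G : SimpleGraph V}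

lemma card_add_card_le_cliqueNum {s : Set V} (hs : ∀ a ∈ s, ∀ b ∉ s, G.Adj a b)
    {K L : Finset V} (hK : G.IsClique (K : Set V)) (hL : G.IsClique (L : Set V))
    (hKs : ∀ w ∈ K, w ∈ s) (hLs : ∀ w ∈ L, w ∉ s) : K.card + L.card ≤ G.cliqueNum := by
  classical
  rw [← Finset.card_union_of_disjoint
    (Finset.disjoint_left.mpr fun w hw hw' => hLs w hw' (hKs w hw))]
  refine IsClique.card_le_cliqueNum (G := G) (tc := ?_)
  intro u hu w hw huw
  simp only [Finset.coe_union, Set.mem_union, Finset.mem_coe] at hu hw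
  rcases hu with hu | hu <;> rcases hw with hw | hw
  · exact hK hu hw huw
  · exact hs u (hKs u hu) w (hLs w hw)
  · exact (hs w (hKs w hw) u (hLs u hu)).symm
  · exact hL hu hw huw

variable [DecidableRel G.Adj]

lemma HasColorBound.colorableOn {s : Set V} (h : HasColorBound G s) :
    ColorableOn G s ((G.maxDegree + G.cliqueNum + 2) / 2) := by
  obtain ⟨v, -, K, -, hK, h⟩ := h
  refine h.mono ?_
  have h₁ := hK.card_le_cliqueNum
  have h₂ := G.degree_le_maxDegree v
  have h₃ : (s ∩ G.neighborSet v).ncard ≤ G.degree v := by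
    rw [← card_neighborFinset_eq_degree, ← Set.ncard_coe_finset, coe_neighborFinset]
    exact Set.ncard_le_ncard Set.inter_subset_right
  omega

lemma ncard_inter_add_ncard_compl_le {s : Set V} (hs : ∀ a ∈ s, ∀ b ∉ s, G.Adj a b) {v : V}
    (hv : v ∈ s) : (s ∩ G.neighborSet v).ncard + sᶜ.ncard ≤ G.maxDegree := by
  refine le_trans ?_ (G.degree_le_maxDegree v)
  rw [← card_neighborFinset_eq_degree, ← Set.ncard_coe_finset, coe_neighborFinset,
    ← Set.ncard_union_eq (disjoint_compl_right.mono_left Set.inter_subset_left)]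
  exact Set.ncard_le_ncard (Set.union_subset Set.inter_subset_right (hs v hv))

/-- The colouring bound passes to joins with a single vertex. -/
lemma colorable_of_universal {v : V} (hv : ∀ w, w ≠ v → G.Adj v w)
    (h : HasColorBound G {v}ᶜ) : G.Colorable ((G.maxDegree + G.cliqueNum + 2) / 2) := by
  classical
  obtain ⟨u, hu, K, hKs, hK, hcol⟩ := h
  have hs : ∀ a ∈ ({v}ᶜ : Set V), ∀ b ∉ ({v}ᶜ : Set V), G.Adj a b := by
    intro a ha b hb
    rw [show b = v by simpa using hb]
    exact (hv a ha).symm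
  have hdeg := ncard_inter_add_ncard_compl_le hs hu
  have hω := card_add_card_le_cliqueNum hs hK (L := {v}) (by simp) hKs (by simp)
  have h₁ : ColorableOn G ({v}ᶜ : Set V)ᶜ 1 := ⟨fun _ => 0, fun a ha b hb hab => by
    rw [show a = v by simpa using ha, show b = v by simpa using hb] at hab
    exact absurd hab G.irrefl⟩
  refine (colorable_join hcol h₁).mono ?_
  rw [Finset.card_singleton] at hω
  rw [compl_compl, Set.ncard_singleton] at hdeg
  omega

/-- The colouring bound passes to joins. -/
lemma coConnected_of_not_colorable (hind : ∀ s : Set V, s.Nonempty → s ≠ Set.univ →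
    HasColorBound G s) (hG : ¬ G.Colorable ((G.maxDegree + G.cliqueNum + 2) / 2)) :
    CoConnected G := by
  classical
  intro A hA hA'
  by_contra! hadj
  obtain ⟨v, hv, K, hKs, hK, hcol⟩ := hind A hA (fun h => by simp [h] at hA')
  obtain ⟨u, hu, L, hLs, hL, hcol'⟩ := hind Aᶜ hA' (fun h => by
    simp [Set.compl_univ_iff.mp h] at hA)
  have hadj' : ∀ a ∈ Aᶜ, ∀ b ∉ Aᶜ, G.Adj a b := fun a ha b hb =>
    (hadj b (by simpa using hb) a ha).symm
  have hdeg := ncard_inter_add_ncard_compl_le hadj hv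
  have hdeg' := ncard_inter_add_ncard_compl_le hadj' hu
  have hω := card_add_card_le_cliqueNum hadj hK hL hKs hLs
  rw [compl_compl] at hdeg'
  by_cases hlt : (A ∩ G.neighborSet v).ncard + 2 ≤ A.ncard
  · refine hG ((colorable_join hcol hcol').mono ?_)
    omega
  · have hvuniv : ∀ w, w ≠ v → G.Adj v w := by
      intro w hw
      by_cases hwA : w ∈ A
      · by_contra hvw
        have hsub : A ∩ G.neighborSet v ⊆ (A \ {v}) \ {w} := fun x hx =>
          ⟨⟨hx.1, (G.ne_of_adj hx.2).symm⟩, by rintro rfl; exact hvw hx.2⟩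
        have h₁ := Set.ncard_le_ncard hsub
        have h₂ := Set.ncard_sdiff_singleton_add_one (show w ∈ A \ {v} from ⟨hwA, hw⟩)
        have h₃ := Set.ncard_sdiff_singleton_add_one hv
        omega
      · exact hadj v hv w hwA
    refine hG (colorable_of_universal hvuniv (hind _ ⟨u, ?_⟩ ?_))
    · rintro rfl
      exact hu hv
    · intro h
      rw [Set.compl_univ_iff] at h
      simp at h

lemma card_le_of_no_independent_triple [Nonempty V] (hα : ∀ x y z, x ≠ y → x ≠ z → y ≠ z →
    ¬ G.Adj x y → ¬ G.Adj x z → ¬ G.Adj y z → False) :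
    Fintype.card V ≤ G.maxDegree + G.cliqueNum + 1 := by
  classical
  obtain ⟨v⟩ := ‹Nonempty V›
  have hK : G.IsClique ((insert v (G.neighborFinset v))ᶜ : Finset V) := by
    intro x hx y hy hxy
    simp only [Finset.coe_compl, Finset.coe_insert, coe_neighborFinset, Set.mem_compl_iff,
      Set.mem_insert_iff, mem_neighborSet, not_or] at hx hy
    by_contra hadj
    exact hα v x y (Ne.symm hx.1) (Ne.symm hy.1) hxy hx.2 hy.2 hadj
  have h₁ := hK.card_le_cliqueNum
  have h₂ := Finset.card_add_card_compl (insert v (G.neighborFinset v))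
  have h₃ := Finset.card_insert_le v (G.neighborFinset v)
  rw [card_neighborFinset_eq_degree] at h₃
  have h₄ := G.degree_le_maxDegree v
  omega

lemma colorable_of_hasColorBound [Nonempty V] (hP : NoP5 G) (hB : NoBanner G)
    (hind : ∀ s : Set V, s.Nonempty → s ≠ Set.univ → HasColorBound G s) :
    G.Colorable ((G.maxDegree + G.cliqueNum + 2) / 2) := by
  by_contra hG
  have hco := coConnected_of_not_colorable hind hG
  have hcut : NoModularCut G := by
    rintro S C hS ⟨c, hc⟩ hCS hC ⟨v, hvC, hvS⟩
    exact hG (colorable_of_modular_cut hS hCS hC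
      (hind (C ∪ S) ⟨c, Or.inl hc⟩ fun h =>
        (h ▸ Set.mem_univ v : v ∈ C ∪ S).elim hvC hvS).colorableOn
      (hind Cᶜ ⟨v, hvC⟩ fun h => (h ▸ Set.mem_univ c : c ∈ Cᶜ) hc).colorableOn)
  have hα : ∀ x y z, x ≠ y → x ≠ z → y ≠ z → ¬ G.Adj x y → ¬ G.Adj x z → ¬ G.Adj y z → False :=
    fun _ _ _ => no_independent_triple hP hB hcut hco
  have hcard := card_le_of_no_independent_triple hα
  generalize hk : (G.maxDegree + G.cliqueNum + 2) / 2 = k at hG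
  have hn : Fintype.card V ≤ 2 * k := by omega
  have hmin : ∀ σ, IsCoMatching G σ → 2 * k + 2 - Fintype.card V ≤ fixCard σ := by
    intro σ hσ
    obtain ⟨r, hr⟩ := even_card_add_fixCard hσ.1
    have : ¬ Fintype.card V + fixCard σ ≤ 2 * k := fun h => hG (colorable_of_coMatching hσ h)
    omega
  have hm := gallai_lemma hco hmin fun v => by
    have hv : ColorableOn G {v}ᶜ k := by
      rcases ({v}ᶜ : Set V).eq_empty_or_nonempty with h | h
      · rw [h]
        exact ⟨fun _ => ⟨0, by omega⟩, fun u hu => hu.elim⟩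
      · exact hk ▸ (hind _ h fun h => (h ▸ Set.mem_univ v : v ∈ ({v}ᶜ : Set V)) rfl).colorableOn
    obtain ⟨σ, hσ, hσv, hle⟩ := exists_coMatching_of_colorableOn hα hv
    have := hmin σ hσ
    exact ⟨σ, hσ, hσv, by omega⟩
  omega

end

/-- The colouring bound for `(P₅, banner)`-free graphs, by strong induction on the order. -/
theorem colorable_of_noP5_of_noBanner (n : ℕ) : ∀ (V : Type) [Fintype V] [Nonempty V]
    (G : SimpleGraph V) [DecidableRel G.Adj], Fintype.card V = n → NoP5 G → NoBanner G →
    G.Colorable ((G.maxDegree + G.cliqueNum + 2) / 2) := by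
  classical
  induction n using Nat.strong_induction_on with
  | _ n ih =>
    intro V _ _ G _ hn hP hB
    refine colorable_of_hasColorBound hP hB fun s hs hs' => hasColorBound_of_induce hs ?_
    have : Nonempty s := hs.to_subtype
    obtain ⟨v, hv⟩ := (Set.ne_univ_iff_exists_notMem s).mp hs'
    exact ih _ (hn ▸ Fintype.card_subtype_lt hv) s (G.induce s) rfl
      (fun a b c d e => hP a b c d e)
      (fun a b c d e h₁ h₂ h₃ h₄ h₅ h₆ h₇ =>
        hB a b c d e h₁ h₂ h₃ h₄ h₅ h₆ (Subtype.coe_injective.ne h₇))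

end main

end

/-- Every finite `(P₅, banner)`-free graph `G` with at least one vertex satisfies
`χ(G) ≤ ⌈(Δ(G) + ω(G) + 1)/2⌉`. -/
theorem stmt9 {V : Type} [Fintype V] [Nonempty V] (G : SimpleGraph V)
    [DecidableRel G.Adj]
    (hP5 : IndFree (pathGraph 5) G) (hbanner : IndFree banner G) :
    G.chromaticNumber ≤ (((G.maxDegree + G.cliqueNum + 1 + 1) / 2 : ℕ) : ℕ∞) :=
  (colorable_of_noP5_of_noBanner _ V G rfl hP5.noP5 hbanner.noBanner).chromaticNumber_le
end
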